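/- arXiv:2301.00279 — 2 statements merged into one kernel-verified Lean document; each statement's English description precedes it below -/
import Mathlib

section
/- Let R be a commutative ring and C an R-module of finitely presented type. The following are equivalent: (1) C is weak w-projective; (2) every w-exact sequence 0 → A → B → C → 0 of R-modules is w-pure exact, i.e., for every R-module M the induced sequence 0 → A ⊗_R M → B ⊗_R M → C ⊗_R M → 0 is w-exact. -/
/-!  Background definitions for the `w`-operation theory of Wang–Kim–Qiao.  -/

open CategoryTheory

section WTheory

variable (R : Type) [CommRing R]

/-- `J` is a Glaz–Vasconcelos ideal: it is finitely generated and the natural map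
`R → Hom_R(J, R)`, sending `r` to multiplication by `r`, is bijective. -/
def IsGVIdeal (J : Ideal R) : Prop :=
  J.FG ∧ Function.Bijective fun r : R => (r • J.subtype : J →ₗ[R] R)

/-- `M` is `GV`-torsion: every element is annihilated by some GV-ideal. -/
def IsGVTorsion (M : Type*) [AddCommGroup M] [Module R M] : Prop :=
  ∀ x : M, ∃ J : Ideal R, IsGVIdeal R J ∧ ∀ j ∈ J, j • x = 0

/-- `M` is `GV`-torsion-free: no nonzero element is annihilated by a GV-ideal. -/
def IsGVTorsionFree (M : Type*) [AddCommGroup M] [Module R M] : Prop :=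
  ∀ x : M, (∃ J : Ideal R, IsGVIdeal R J ∧ ∀ j ∈ J, j • x = 0) → x = 0

/-- `Ext^n_R(M, N)`, as an `R`-module. -/
noncomputable def extM (M N : Type) [AddCommGroup M] [Module R M]
    [AddCommGroup N] [Module R N] (n : ℕ) : ModuleCat R :=
  ((Ext R (ModuleCat R) n).obj (Opposite.op (ModuleCat.of R M))).obj (ModuleCat.of R N)

/-- `M` is a `w`-module: it is GV-torsion-free and `Ext^1_R(R/J, M) = 0`
for every GV-ideal `J`. -/
def IsWModule (M : Type) [AddCommGroup M] [Module R M] : Prop :=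
  IsGVTorsionFree R M ∧
    ∀ J : Ideal R, IsGVIdeal R J → Subsingleton (extM R (R ⧸ J) M 1)

/-- `(L, ι)` is a `w`-envelope of `M`: `L` is a `w`-module, `ι : M → L` is an injective
linear map, and its cokernel is GV-torsion. -/
def IsWEnvelope (M L : Type) [AddCommGroup M] [Module R M] [AddCommGroup L]
    [Module R L] (ι : M →ₗ[R] L) : Prop :=
  IsWModule R L ∧ Function.Injective ι ∧ IsGVTorsion R (L ⧸ LinearMap.range ι)

/-- The GV-torsion submodule `tor_GV(M)`.  (The displayed generating set is already closed
under the module operations, since the GV-ideals form a multiplicative system of ideals,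
so the span coincides with the displayed set.) -/
def torGV (M : Type) [AddCommGroup M] [Module R M] : Submodule R M :=
  Submodule.span R {x : M | ∃ J : Ideal R, IsGVIdeal R J ∧ ∀ j ∈ J, j • x = 0}

/-- `M` is `w`-projective: for every GV-torsion-free `w`-module `N` and every
`w`-envelope `(L, ι)` of `M / tor_GV(M)`, the module `Ext^1_R(L, N)` is GV-torsion. -/
def IsWProjective (M : Type) [AddCommGroup M] [Module R M] : Prop :=
  ∀ (N : Type) [AddCommGroup N] [Module R N], IsGVTorsionFree R N → IsWModule R N →
    ∀ (L : Type) [AddCommGroup L] [Module R L] (ι : (M ⧸ torGV R M) →ₗ[R] L),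
      IsWEnvelope R (M ⧸ torGV R M) L ι → IsGVTorsion R (extM R L N 1)

/-- `N` belongs to the class `P_w^{†∞}`: it is GV-torsion-free and
`Ext^k_R(M, N) = 0` for every `w`-projective `M` and every `k ≥ 1`. -/
def MemPwDaggerInfty (N : Type) [AddCommGroup N] [Module R N] : Prop :=
  IsGVTorsionFree R N ∧
    ∀ (M : Type) [AddCommGroup M] [Module R M], IsWProjective R M →
      ∀ k : ℕ, 1 ≤ k → Subsingleton (extM R M N k)

/-- `M` is weak `w`-projective: `Ext^1_R(M, N) = 0` for every `N ∈ P_w^{†∞}`. -/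
def IsWeakWProjective (M : Type) [AddCommGroup M] [Module R M] : Prop :=
  ∀ (N : Type) [AddCommGroup N] [Module R N], MemPwDaggerInfty R N →
    Subsingleton (extM R M N 1)

end WTheory

section WExactness

variable (R : Type) [CommRing R]

/-- `I` is a `w`-ideal of `R`. -/
def IsWIdeal (I : Ideal R) : Prop :=
  ∀ x : R, (∃ J : Ideal R, IsGVIdeal R J ∧ ∀ j ∈ J, j * x ∈ I) → x ∈ I

/-- `P` is a maximal `w`-ideal: it is maximal among proper `w`-ideals of `R`.
(Every maximal `w`-ideal is a prime ideal.) -/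
def IsMaxWIdeal (P : Ideal R) : Prop :=
  IsWIdeal R P ∧ P ≠ ⊤ ∧ ∀ I : Ideal R, IsWIdeal R I → I ≠ ⊤ → P ≤ I → I = P

/-- The localization of a linear map at a submonoid. -/
noncomputable def locMap (S : Submonoid R) {A B : Type} [AddCommGroup A] [Module R A]
    [AddCommGroup B] [Module R B] (f : A →ₗ[R] B) :
    LocalizedModule S A →ₗ[R] LocalizedModule S B :=
  IsLocalizedModule.map S (LocalizedModule.mkLinearMap S A) (LocalizedModule.mkLinearMap S B) f

/-- `f` is a `w`-monomorphism: its localization at every maximal `w`-ideal is injective. -/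
def IsWMono {A B : Type} [AddCommGroup A] [Module R A] [AddCommGroup B] [Module R B]
    (f : A →ₗ[R] B) : Prop :=
  ∀ (P : Ideal R), IsMaxWIdeal R P → ∀ [P.IsPrime],
    Function.Injective (locMap R P.primeCompl f)

/-- `f` is a `w`-epimorphism: its localization at every maximal `w`-ideal is surjective. -/
def IsWEpi {A B : Type} [AddCommGroup A] [Module R A] [AddCommGroup B] [Module R B]
    (f : A →ₗ[R] B) : Prop :=
  ∀ (P : Ideal R), IsMaxWIdeal R P → ∀ [P.IsPrime],
    Function.Surjective (locMap R P.primeCompl f)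

/-- `0 → A → B → C → 0` is a `w`-exact sequence: its localization at every maximal
`w`-ideal is a short exact sequence. -/
def IsWShortExact {A B C : Type} [AddCommGroup A] [Module R A] [AddCommGroup B] [Module R B]
    [AddCommGroup C] [Module R C] (f : A →ₗ[R] B) (g : B →ₗ[R] C) : Prop :=
  ∀ (P : Ideal R), IsMaxWIdeal R P → ∀ [P.IsPrime],
    Function.Injective (locMap R P.primeCompl f) ∧
    Function.Exact (locMap R P.primeCompl f) (locMap R P.primeCompl g) ∧
    Function.Surjective (locMap R P.primeCompl g)

/-- `M` is of finite type: there is a `w`-epimorphism from a finitely generated free module. -/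
def IsFiniteType (M : Type) [AddCommGroup M] [Module R M] : Prop :=
  ∃ (n : ℕ) (g : (Fin n → R) →ₗ[R] M), IsWEpi R g

/-- `M` is of finitely presented type: there is a `w`-exact sequence
`F₁ → F₀ → M → 0` with `F₁`, `F₀` finitely generated free. -/
def IsFinitelyPresentedType (M : Type) [AddCommGroup M] [Module R M] : Prop :=
  ∃ (m n : ℕ) (f : (Fin m → R) →ₗ[R] (Fin n → R)) (g : (Fin n → R) →ₗ[R] M),
    IsWEpi R g ∧ ∀ (P : Ideal R), IsMaxWIdeal R P → ∀ [P.IsPrime],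
      Function.Exact (locMap R P.primeCompl f) (locMap R P.primeCompl g)

/-- `M` is `w`-flat: tensoring with `M` preserves `w`-monomorphisms. -/
def IsWFlat (M : Type) [AddCommGroup M] [Module R M] : Prop :=
  ∀ (A B : Type) [AddCommGroup A] [Module R A] [AddCommGroup B] [Module R B]
    (f : A →ₗ[R] B), IsWMono R f → IsWMono R (LinearMap.lTensor M f)

end WExactness

section ExtComputation

variable {R : Type} [CommRing R]

theorem exists_lift_range {A B N : Type*} [AddCommGroup A] [Module R A] [AddCommGroup B]
    [Module R B] [AddCommGroup N] [Module R N] (T : A →ₗ[R] B) (θ : A →ₗ[R] N)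
    (h : ∀ a, T a = 0 → θ a = 0) :
    ∃ θ' : LinearMap.range T →ₗ[R] N, ∀ a, θ' ⟨T a, a, rfl⟩ = θ a := by
  refine ⟨(LinearMap.ker T).liftQ θ h ∘ₗ T.quotKerEquivRange.symm.toLinearMap, fun a => ?_⟩
  have : T.quotKerEquivRange.symm ⟨T a, a, rfl⟩ = (LinearMap.ker T).mkQ a := by
    rw [LinearEquiv.symm_apply_eq]
    rfl
  change (LinearMap.ker T).liftQ θ h (T.quotKerEquivRange.symm ⟨T a, a, rfl⟩) = θ a
  rw [this]
  rfl

/-- The extension groups of positive degree, computed from a projective resolution. -/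
noncomputable def extSuccEquiv (M N : Type) [AddCommGroup M] [Module R M]
    [AddCommGroup N] [Module R N] (P : ProjectiveResolution (ModuleCat.of R M)) (n : ℕ) :
    extM R M N (n + 1) ≃ₗ[R]
      ((P.complex.linearYonedaObj R (ModuleCat.of R N)).sc' n (n + 1)
        (n + 2)).moduleCatLeftHomologyData.H :=
  (P.isoExt (R := R) (n + 1) (ModuleCat.of R N) ≪≫
    (P.complex.linearYonedaObj R (ModuleCat.of R N)).homologyIsoSc' n (n + 1) (n + 2)
      (by simp) (by simp) ≪≫ ShortComplex.moduleCatHomologyIso _).toLinearEquiv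

theorem exists_cocycles_surjection_ext (M N : Type) [AddCommGroup M] [Module R M]
    [AddCommGroup N] [Module R N] (P : ProjectiveResolution (ModuleCat.of R M)) (n : ℕ) :
    ∃ Φ : LinearMap.ker (LinearMap.lcomp R N (P.complex.d (n + 2) (n + 1)).hom) →ₗ[R]
        extM R M N (n + 1),
      Function.Surjective Φ ∧
        ∀ φ, Φ φ = 0 ↔ ∃ ψ : P.complex.X n →ₗ[R] N, ψ ∘ₗ (P.complex.d (n + 1) n).hom = φ.1 := by
  let S := (P.complex.linearYonedaObj R (ModuleCat.of R N)).sc' n (n + 1) (n + 2)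
  let e : LinearMap.ker (LinearMap.lcomp R N (P.complex.d (n + 2) (n + 1)).hom) →ₗ[R]
      LinearMap.ker S.g.hom :=
    { toFun := fun φ => ⟨ModuleCat.ofHom φ.1, by
        have h : φ.1 ∘ₗ (P.complex.d (n + 2) (n + 1)).hom = 0 := LinearMap.mem_ker.mp φ.2
        have h' : P.complex.d (n + 2) (n + 1) ≫ ModuleCat.ofHom φ.1 = 0 := ModuleCat.hom_ext h
        exact h'⟩
      map_add' := fun _ _ => rfl
      map_smul' := fun _ _ => rfl }
  have he : Function.Surjective e := by
    rintro ⟨φ, hφ⟩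
    refine ⟨⟨ModuleCat.Hom.hom φ, ?_⟩, rfl⟩
    have h' : P.complex.d (n + 2) (n + 1) ≫ (show P.complex.X (n + 1) ⟶ ModuleCat.of R N from φ) =
      0 := hφ
    exact LinearMap.mem_ker.mpr (congrArg ModuleCat.Hom.hom h')
  let q : LinearMap.ker S.g.hom →ₗ[R] S.moduleCatLeftHomologyData.H :=
    (LinearMap.range S.moduleCatToCycles).mkQ
  have hq : Function.Surjective q := Submodule.mkQ_surjective _
  refine ⟨(extSuccEquiv M N P n).symm.toLinearMap ∘ₗ q ∘ₗ e,
    (extSuccEquiv M N P n).symm.surjective.comp (hq.comp he), fun φ => ?_⟩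
  have h1 : q (e φ) = 0 ↔ e φ ∈ LinearMap.range S.moduleCatToCycles :=
    Submodule.Quotient.mk_eq_zero _
  simp only [LinearMap.coe_comp, LinearEquiv.coe_coe, Function.comp_apply,
    EmbeddingLike.map_eq_zero_iff]
  rw [h1]
  constructor
  · rintro ⟨ψ, hψ⟩
    exact ⟨ModuleCat.Hom.hom ψ, congrArg ModuleCat.Hom.hom (congrArg Subtype.val hψ)⟩
  · rintro ⟨ψ, hψ⟩
    exact ⟨ModuleCat.ofHom ψ, Subtype.ext (ModuleCat.hom_ext hψ)⟩

instance (M : Type) [AddCommGroup M] [Module R M]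
    (P : ProjectiveResolution (ModuleCat.of R M)) (n : ℕ) :
    Module.Projective R (P.complex.X n) :=
  (IsProjective.iff_projective (R := R) (P.complex.X n)).mpr (P.projective n)

/-- The augmentation of a projective resolution. -/
noncomputable def resolutionAugmentation {M : Type} [AddCommGroup M] [Module R M]
    (P : ProjectiveResolution (ModuleCat.of R M)) : P.complex.X 0 →ₗ[R] M :=
  ModuleCat.Hom.hom (A := P.complex.X 0) (B := ModuleCat.of R M) (P.π.f 0)

theorem resolutionAugmentation_surjective {M : Type} [AddCommGroup M] [Module R M]
    (P : ProjectiveResolution (ModuleCat.of R M)) :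
    Function.Surjective (resolutionAugmentation P) :=
  (ModuleCat.epi_iff_surjective (P.π.f 0)).mp inferInstance

theorem exact_resolutionAugmentation {M : Type} [AddCommGroup M] [Module R M]
    (P : ProjectiveResolution (ModuleCat.of R M)) :
    Function.Exact (P.complex.d 1 0).hom (resolutionAugmentation P) :=
  (ShortComplex.ShortExact.moduleCat_exact_iff_function_exact _).mp
    (ShortComplex.exact_of_g_is_cokernel
      (ShortComplex.mk _ _ P.complex_d_comp_π_f_zero) P.isColimitCokernelCofork)

theorem exact_complex_d {M : Type} [AddCommGroup M] [Module R M]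
    (P : ProjectiveResolution (ModuleCat.of R M)) (n : ℕ) :
    Function.Exact (P.complex.d (n + 2) (n + 1)).hom (P.complex.d (n + 1) n).hom :=
  (ShortComplex.ShortExact.moduleCat_exact_iff_function_exact _).mp (P.exact_succ n)

/-- The maps on the kernel of a projective presentation `p : F → L`, modulo those extending
to `F`, compute `Ext^1`. -/
theorem exists_ker_surjection_ext {L N F : Type} [AddCommGroup L] [Module R L]
    [AddCommGroup N] [Module R N] [AddCommGroup F] [Module R F] [Module.Projective R F]
    (p : F →ₗ[R] L) (hp : Function.Surjective p) :
    ∃ Φ : (LinearMap.ker p →ₗ[R] N) →ₗ[R] extM R L N 1,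
      Function.Surjective Φ ∧
        ∀ φ, Φ φ = 0 ↔ ∃ ψ : F →ₗ[R] N, ψ ∘ₗ (LinearMap.ker p).subtype = φ := by
  let P := projectiveResolution (ModuleCat.of R L)
  let ε := resolutionAugmentation P
  let d : P.complex.X 1 →ₗ[R] P.complex.X 0 := (P.complex.d 1 0).hom
  let d' : P.complex.X 2 →ₗ[R] P.complex.X 1 := (P.complex.d 2 1).hom
  have hd : Function.Exact d ε := exact_resolutionAugmentation P
  have hd' : Function.Exact d' d := exact_complex_d P 0
  obtain ⟨α, hα⟩ := Module.projective_lifting_property ε p (resolutionAugmentation_surjective P)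
  obtain ⟨β, hβ⟩ := Module.projective_lifting_property p ε hp
  replace hα : ∀ x, ε (α x) = p x := fun x => congr($hα x)
  replace hβ : ∀ x, p (β x) = ε x := fun x => congr($hβ x)
  have hβd : ∀ x, β (d x) ∈ LinearMap.ker p := fun x => by
    rw [LinearMap.mem_ker, hβ, hd.apply_apply_eq_zero]
  let γ : P.complex.X 1 →ₗ[R] LinearMap.ker p := (β ∘ₗ d).codRestrict _ hβd
  obtain ⟨Φ, hΦ, hΦ0⟩ := exists_cocycles_surjection_ext L N P 0
  let c : (LinearMap.ker p →ₗ[R] N) →ₗ[R]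
      LinearMap.ker (LinearMap.lcomp R N (P.complex.d 2 1).hom) :=
    (LinearMap.lcomp R N γ).codRestrict _ fun φ => by
      rw [LinearMap.mem_ker]
      ext x
      have : γ (d' x) = 0 := Subtype.ext (by
        change β (d (d' x)) = 0
        rw [hd'.apply_apply_eq_zero, map_zero])
      change φ (γ (d' x)) = 0
      rw [this, map_zero]
  refine ⟨Φ ∘ₗ c, ?_, fun φ => ?_⟩
  · intro x
    obtain ⟨⟨χ, hχ⟩, rfl⟩ := hΦ x
    have hχd : ∀ y, χ (d' y) = 0 := fun y => congr($(LinearMap.mem_ker.mp hχ) y)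
    obtain ⟨χ', hχ'⟩ := exists_lift_range d χ fun y hy => by
      obtain ⟨z, rfl⟩ := (hd' y).mp hy
      exact hχd z
    have hαk : ∀ x : LinearMap.ker p, α x.1 ∈ LinearMap.range d := fun x =>
      (hd (α x.1)).mp (by rw [hα]; exact x.2)
    have hk : ∀ x, α (β x) - x ∈ LinearMap.range d := fun x =>
      (hd _).mp (by rw [map_sub, hα, hβ, sub_self])
    let φ : LinearMap.ker p →ₗ[R] N :=
      χ' ∘ₗ (α ∘ₗ (LinearMap.ker p).subtype).codRestrict _ hαk
    refine ⟨φ, ?_⟩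
    rw [← sub_eq_zero, LinearMap.comp_apply, ← map_sub, hΦ0]
    refine ⟨χ' ∘ₗ (α ∘ₗ β - LinearMap.id).codRestrict _ hk, ?_⟩
    ext y
    have h2 : χ' ⟨α (β (d y)) - d y, hk (d y)⟩ = χ' ⟨α (β (d y)), hαk (γ y)⟩ - χ y := by
      rw [← hχ', ← map_sub]
      rfl
    exact h2
  · rw [LinearMap.comp_apply, hΦ0]
    constructor
    · rintro ⟨ψ, hψ⟩
      have hψ' : ∀ x, ψ (d x) = φ (γ x) := fun x => congr($hψ x)
      have hk : ∀ x, x - β (α x) ∈ LinearMap.ker p := fun x => by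
        rw [LinearMap.mem_ker, map_sub, hβ, hα, sub_self]
      refine ⟨ψ ∘ₗ α + φ ∘ₗ (LinearMap.id - β ∘ₗ α).codRestrict _ hk, ?_⟩
      ext ⟨x, hx⟩
      obtain ⟨y, hy⟩ := (hd (α x)).mp (by rw [hα]; exact hx)
      have h1 : ψ (α x) = φ (γ y) := by rw [← hy, hψ']
      change ψ (α x) + φ ⟨x - β (α x), hk x⟩ = φ ⟨x, hx⟩
      rw [h1, ← map_add]
      congr 1
      ext
      change β (d y) + (x - β (α x)) = x
      rw [hy]; abel
    · rintro ⟨ψ, rfl⟩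
      exact ⟨ψ ∘ₗ β, rfl⟩

end ExtComputation

section GVIdeals

variable {R : Type} [CommRing R]

theorem IsGVIdeal.eq_zero {J : Ideal R} (hJ : IsGVIdeal R J) {r : R}
    (h : ∀ j ∈ J, r * j = 0) : r = 0 :=
  hJ.2.1 (LinearMap.ext fun j => by simpa using h j j.2)

theorem IsGVIdeal.exists_eq_mul {J : Ideal R} (hJ : IsGVIdeal R J) (f : J →ₗ[R] R) :
    ∃ r, ∀ j : J, f j = r * j := by
  obtain ⟨r, rfl⟩ := hJ.2.2 f
  exact ⟨r, fun j => rfl⟩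

theorem isGVIdeal_of {J : Ideal R} (hfg : J.FG) (h0 : ∀ r, (∀ j ∈ J, r * j = 0) → r = 0)
    (h : ∀ f : J →ₗ[R] R, ∃ r, ∀ j : J, f j = r * j) : IsGVIdeal R J := by
  refine ⟨hfg, fun r s hrs => sub_eq_zero.mp (h0 _ fun j hj => ?_), fun f => ?_⟩
  · have : r * j = s * j := congr($hrs ⟨j, hj⟩)
    rw [sub_mul, this, sub_self]
  · obtain ⟨r, hr⟩ := h f
    exact ⟨r, LinearMap.ext fun j => (hr j).symm⟩

theorem isGVIdeal_top : IsGVIdeal R ⊤ := by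
  refine isGVIdeal_of Module.Finite.fg_top (fun r h => by simpa using h 1 trivial) fun f => ?_
  refine ⟨f ⟨1, trivial⟩, fun j => ?_⟩
  rw [mul_comm, ← smul_eq_mul, ← map_smul]
  congr 1
  ext
  simp

theorem IsGVIdeal.mul {I J : Ideal R} (hI : IsGVIdeal R I) (hJ : IsGVIdeal R J) :
    IsGVIdeal R (I * J) := by
  have h0 : ∀ r, (∀ j ∈ I * J, r * j = 0) → r = 0 := fun r h =>
    hI.eq_zero fun i hi => hJ.eq_zero fun j hj => by
      rw [mul_assoc]; exact h _ (Ideal.mul_mem_mul hi hj)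
  refine isGVIdeal_of (hI.1.mul hJ.1) h0 fun f => ?_
  have hex : ∀ i : I, ∃ r, ∀ j : J, f ⟨i * j, Ideal.mul_mem_mul i.2 j.2⟩ = r * j := fun i =>
    hJ.exists_eq_mul
      (f ∘ₗ ((LinearMap.mulLeft R (i : R)) ∘ₗ J.subtype).codRestrict (I * J)
        fun j => Ideal.mul_mem_mul i.2 j.2)
  choose g hg using hex
  have hadd : ∀ a b : I, g (a + b) = g a + g b := fun a b =>
    sub_eq_zero.mp (hJ.eq_zero fun j hj => by
      rw [sub_mul, add_mul, ← hg a ⟨j, hj⟩, ← hg b ⟨j, hj⟩, ← hg (a + b) ⟨j, hj⟩, ← map_add,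
        sub_eq_zero]
      congr 1
      ext
      simp [add_mul])
  have hsmul : ∀ (c : R) (a : I), g (c • a) = c * g a := fun c a =>
    sub_eq_zero.mp (hJ.eq_zero fun j hj => by
      rw [sub_mul, mul_assoc, ← hg a ⟨j, hj⟩, ← hg (c • a) ⟨j, hj⟩, sub_eq_zero]
      refine (congrArg f ?_).trans (f.map_smul c _)
      ext
      simp [mul_assoc])
  obtain ⟨r, hr⟩ := hI.exists_eq_mul
    { toFun := g, map_add' := hadd, map_smul' := hsmul }
  refine ⟨r, ?_⟩
  rintro ⟨x, hx⟩
  induction hx using Submodule.mul_induction_on' with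
  | mem_mul_mem i hi j hj =>
    rw [hg ⟨i, hi⟩ ⟨j, hj⟩, ← mul_assoc]
    exact congrArg (· * j) (hr ⟨i, hi⟩)
  | add x hx y hy h1 h2 =>
    rw [mul_add, ← h1, ← h2, ← map_add]
    rfl

theorem IsMaxWIdeal.not_isGVIdeal_le {P : Ideal R} (hP : IsMaxWIdeal R P) {J : Ideal R}
    (hJ : IsGVIdeal R J) : ¬ J ≤ P := fun h =>
  hP.2.1 ((Ideal.eq_top_iff_one P).mpr (hP.1 1 ⟨J, hJ, fun j hj => by simpa using h hj⟩))

theorem IsMaxWIdeal.exists_mem_primeCompl {P : Ideal R} (hP : IsMaxWIdeal R P) [P.IsPrime]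
    {J : Ideal R} (hJ : IsGVIdeal R J) : ∃ s ∈ P.primeCompl, s ∈ J := by
  obtain ⟨s, hs, hsP⟩ := Set.not_subset.mp (hP.not_isGVIdeal_le hJ)
  exact ⟨s, hsP, hs⟩

theorem IsMaxWIdeal.isPrime {P : Ideal R} (hP : IsMaxWIdeal R P) : P.IsPrime := by
  refine ⟨hP.2.1, fun {a b} hab => or_iff_not_imp_left.mpr fun ha => ?_⟩
  let Q : Ideal R := Submodule.comap (LinearMap.mulRight R a) P
  have hQ : Q = P := by
    refine hP.2.2 Q ?_ ?_ fun x hx => P.mul_mem_right a hx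
    · rintro x ⟨J, hJ, h⟩
      exact hP.1 _ ⟨J, hJ, fun j hj => by
        have : j * x * a ∈ P := h j hj
        rwa [mul_assoc] at this⟩
    · intro h
      have : (1 : R) * a ∈ P := (h ▸ trivial : (1 : R) ∈ Q)
      exact ha (by simpa using this)
  rw [← hQ]
  change b * a ∈ P
  rwa [mul_comm]

/-- The `w`-closure of an ideal. -/
def wClosure (I : Ideal R) : Ideal R where
  carrier := {x | ∃ J : Ideal R, IsGVIdeal R J ∧ ∀ j ∈ J, j * x ∈ I}
  zero_mem' := ⟨⊤, isGVIdeal_top, fun j _ => by simp⟩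
  add_mem' := by
    rintro x y ⟨J, hJ, hx⟩ ⟨K, hK, hy⟩
    refine ⟨J * K, hJ.mul hK, fun j hj => ?_⟩
    rw [mul_add]
    exact I.add_mem (hx j (Ideal.mul_le_left hj)) (hy j (Ideal.mul_le_right hj))
  smul_mem' := by
    rintro c x ⟨J, hJ, hx⟩
    exact ⟨J, hJ, fun j hj => by
      rw [smul_eq_mul, mul_left_comm]; exact I.mul_mem_left c (hx j hj)⟩

theorem exists_isGVIdeal_mul_le {I K : Ideal R} (hK : K.FG) (h : K ≤ wClosure I) :
    ∃ J : Ideal R, IsGVIdeal R J ∧ J * K ≤ I := by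
  induction K, hK using Submodule.fg_induction with
  | singleton x =>
    obtain ⟨J, hJ, hx⟩ := h (Submodule.mem_span_singleton_self x)
    refine ⟨J, hJ, ?_⟩
    rw [Ideal.mul_le]
    intro j hj y hy
    obtain ⟨c, rfl⟩ := Submodule.mem_span_singleton.mp hy
    rw [smul_eq_mul, mul_left_comm]
    exact I.mul_mem_left c (hx j hj)
  | sup K₁ K₂ _ _ h₁ h₂ =>
    obtain ⟨J₁, hJ₁, h₁⟩ := h₁ (le_sup_left.trans h)
    obtain ⟨J₂, hJ₂, h₂⟩ := h₂ (le_sup_right.trans h)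
    refine ⟨J₁ * J₂, hJ₁.mul hJ₂, ?_⟩
    rw [Ideal.mul_sup]
    exact sup_le ((Ideal.mul_mono_left Ideal.mul_le_left).trans h₁)
      ((Ideal.mul_mono_left Ideal.mul_le_right).trans h₂)

theorem isWIdeal_wClosure (I : Ideal R) : IsWIdeal R (wClosure I) := by
  rintro x ⟨J, hJ, h⟩
  obtain ⟨K, hK, hKJ⟩ := exists_isGVIdeal_mul_le (I := I) (K := J * Ideal.span {x})
    (hJ.1.mul (Submodule.fg_span_singleton x)) (by
      rw [Ideal.mul_le]
      intro j hj y hy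
      obtain ⟨c, rfl⟩ := Ideal.mem_span_singleton'.mp hy
      rw [mul_left_comm]
      exact (wClosure I).mul_mem_left c (h j hj))
  refine ⟨K * J, hK.mul hJ, fun j hj => hKJ ?_⟩
  rw [← mul_assoc]
  exact Ideal.mul_mem_mul hj (Submodule.mem_span_singleton_self x)

theorem le_wClosure (I : Ideal R) : I ≤ wClosure I := fun _ hx =>
  ⟨⊤, isGVIdeal_top, fun j _ => I.mul_mem_left j hx⟩

theorem exists_isMaxWIdeal_le {I : Ideal R} (hI : IsWIdeal R I) (hI1 : I ≠ ⊤) :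
    ∃ P, IsMaxWIdeal R P ∧ I ≤ P := by
  obtain ⟨P, hIP, hP⟩ := zorn_le_nonempty₀ {I : Ideal R | IsWIdeal R I ∧ I ≠ ⊤}
    (fun c hc hchain y hy => by
      refine ⟨sSup c, ⟨?_, ?_⟩, fun z hz => le_sSup hz⟩
      · rintro x ⟨J, hJ, h⟩
        have hle : J * Ideal.span {x} ≤ sSup c := by
          rw [Ideal.mul_le]
          intro j hj y hy
          obtain ⟨a, rfl⟩ := Ideal.mem_span_singleton'.mp hy
          rw [mul_left_comm]
          exact (sSup c).mul_mem_left a (h j hj)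
        have hcomp := (Submodule.fg_iff_compact _).mp
          (hJ.1.mul (Submodule.fg_span_singleton x) : (J * Ideal.span {x}).FG)
        obtain ⟨K, hKc, hK⟩ := (CompleteLattice.isCompactElement_iff_le_of_directed_sSup_le _ _).mp
          hcomp c ⟨y, hy⟩ hchain.directedOn hle
        refine le_sSup hKc ((hc hKc).1 x ⟨J, hJ, fun j hj => hK ?_⟩)
        exact Ideal.mul_mem_mul hj (Submodule.mem_span_singleton_self x)
      · intro htop
        have h1 : (1 : R) ∈ sSup c := htop ▸ trivial
        obtain ⟨K, hKc, hK⟩ := (Submodule.mem_sSup_of_directed ⟨y, hy⟩ hchain.directedOn).mp h1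
        exact (hc hKc).2 ((Ideal.eq_top_iff_one K).mpr hK)) I ⟨hI, hI1⟩
  exact ⟨P, ⟨hP.1.1, hP.1.2, fun K hK hK1 hPK => (hP.2 ⟨hK, hK1⟩ hPK).antisymm hPK⟩, hIP⟩

/-- An ideal contains a GV-ideal as soon as no maximal `w`-ideal contains it. -/
theorem exists_isGVIdeal_le {I : Ideal R}
    (h : ∀ P : Ideal R, IsMaxWIdeal R P → ∀ [P.IsPrime], ∃ s ∈ P.primeCompl, s ∈ I) :
    ∃ J : Ideal R, IsGVIdeal R J ∧ J ≤ I := by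
  by_cases htop : wClosure I = ⊤
  · obtain ⟨J, hJ, h1⟩ := (Ideal.eq_top_iff_one _).mp htop
    exact ⟨J, hJ, fun j hj => by simpa using h1 j hj⟩
  · obtain ⟨P, hP, hIP⟩ := exists_isMaxWIdeal_le (isWIdeal_wClosure I) htop
    have := hP.isPrime
    obtain ⟨s, hsP, hsI⟩ := h P hP
    exact absurd (hIP (le_wClosure I hsI)) hsP

end GVIdeals

section WModules

variable {R : Type} [CommRing R]

/-- The elements of `S` act bijectively on `X`. -/
def ActsBijectively (S : Submonoid R) (X : Type) [AddCommGroup X] [Module R X] : Prop :=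
  ∀ s ∈ S, Function.Bijective fun x : X => s • x

theorem actsBijectively_localizedModule (S : Submonoid R) (X : Type) [AddCommGroup X]
    [Module R X] : ActsBijectively S (LocalizedModule S X) := fun s hs =>
  (Module.End.isUnit_iff _).mp
    (IsLocalizedModule.map_units (LocalizedModule.mkLinearMap S X) ⟨s, hs⟩)

theorem ActsBijectively.characterModule {S : Submonoid R} {X : Type} [AddCommGroup X]
    [Module R X] (h : ActsBijectively S X) : ActsBijectively S (CharacterModule X) := fun s hs =>
  (CharacterModule.dual_bijective_iff_bijective (f := LinearMap.lsmul R X s)).mpr (h s hs)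

theorem ActsBijectively.tensorProduct_right {S : Submonoid R} {X : Type} [AddCommGroup X]
    [Module R X] (h : ActsBijectively S X) (K : Type) [AddCommGroup K] [Module R K] :
    ActsBijectively S (TensorProduct R K X) := fun s hs => by
  let e := (LinearEquiv.ofBijective (LinearMap.lsmul R X s) (h s hs)).lTensor K
  have he : ∀ x, e x = s • x := fun x => by
    induction x using TensorProduct.induction_on with
    | zero => simp
    | tmul a b => exact TensorProduct.tmul_smul s a b
    | add a b ha hb => rw [map_add, ha, hb, smul_add]
  exact (funext he : ⇑e = _) ▸ e.bijective

theorem ActsBijectively.tensorProduct_left {S : Submonoid R} {K : Type} [AddCommGroup K]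
    [Module R K] (h : ActsBijectively S K) (X : Type) [AddCommGroup X] [Module R X] :
    ActsBijectively S (TensorProduct R K X) := fun s hs => by
  let e := (LinearEquiv.ofBijective (LinearMap.lsmul R K s) (h s hs)).rTensor X
  have he : ∀ x, e x = s • x := fun x => by
    induction x using TensorProduct.induction_on with
    | zero => simp
    | tmul a b => rfl
    | add a b ha hb => rw [map_add, ha, hb, smul_add]
  exact (funext he : ⇑e = _) ▸ e.bijective

theorem ActsBijectively.injective_of_isLocalizedModule {S : Submonoid R} {X Y : Type}
    [AddCommGroup X] [Module R X] [AddCommGroup Y] [Module R Y] (h : ActsBijectively S X)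
    (f : X →ₗ[R] Y) [IsLocalizedModule S f] : Function.Injective f := fun x y hxy => by
  obtain ⟨c, hc⟩ := (IsLocalizedModule.eq_iff_exists S f).mp hxy
  exact (h c c.2).1 hc

theorem ActsBijectively.isGVTorsionFree {P : Ideal R} [P.IsPrime] (hP : IsMaxWIdeal R P)
    {X : Type} [AddCommGroup X] [Module R X] (h : ActsBijectively P.primeCompl X) :
    IsGVTorsionFree R X := by
  rintro x ⟨J, hJ, hx⟩
  obtain ⟨s, hs, hsJ⟩ := hP.exists_mem_primeCompl hJ
  exact (h s hs).1 (by simpa using hx s hsJ)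

theorem isWModule_iff (N : Type) [AddCommGroup N] [Module R N] :
    IsWModule R N ↔ IsGVTorsionFree R N ∧ ∀ J : Ideal R, IsGVIdeal R J →
      ∀ φ : J →ₗ[R] N, ∃ y, ∀ j : J, φ j = (j : R) • y := by
  refine and_congr_right fun _ => forall₂_congr fun J hJ => ?_
  obtain ⟨Φ, hΦ, hΦ0⟩ := exists_ker_surjection_ext (N := N) J.mkQ J.mkQ_surjective
  have hmem : ∀ x, x ∈ LinearMap.ker J.mkQ ↔ x ∈ J := fun x => by rw [Submodule.ker_mkQ]
  constructor
  · intro h φ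
    obtain ⟨ψ, hψ⟩ := (hΦ0 (φ ∘ₗ (LinearEquiv.ofEq _ _ J.ker_mkQ).toLinearMap)).mp
      (Subsingleton.elim _ _)
    refine ⟨ψ 1, fun j => ?_⟩
    rw [← map_smul, smul_eq_mul, mul_one]
    exact congr($hψ ⟨j, (hmem j).mpr j.2⟩).symm
  · intro h
    refine subsingleton_of_forall_eq 0 fun x => ?_
    obtain ⟨φ, rfl⟩ := hΦ x
    obtain ⟨y, hy⟩ := h (φ ∘ₗ (LinearEquiv.ofEq _ _ J.ker_mkQ).symm.toLinearMap)
    refine (hΦ0 φ).mpr ⟨LinearMap.toSpanSingleton R N y, ?_⟩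
    ext ⟨x, hx⟩
    exact (hy ⟨x, (hmem x).mp hx⟩).symm

theorem ActsBijectively.isWModule {P : Ideal R} [P.IsPrime] (hP : IsMaxWIdeal R P)
    {X : Type} [AddCommGroup X] [Module R X] (h : ActsBijectively P.primeCompl X) :
    IsWModule R X := by
  refine (isWModule_iff X).mpr ⟨h.isGVTorsionFree hP, fun J hJ φ => ?_⟩
  obtain ⟨s, hs, hsJ⟩ := hP.exists_mem_primeCompl hJ
  obtain ⟨y, hy⟩ := (h s hs).2 (φ ⟨s, hsJ⟩)
  refine ⟨y, fun j => (h s hs).1 ?_⟩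
  change s • φ j = s • (j : R) • y
  rw [smul_comm, show s • y = φ ⟨s, hsJ⟩ from hy, ← map_smul, ← map_smul]
  congr 1
  ext
  exact mul_comm _ _

/-- Maps into a `w`-module extend uniquely along maps with GV-torsion cokernel. -/
theorem IsWModule.exists_extension {N A B : Type} [AddCommGroup N] [Module R N]
    [AddCommGroup A] [Module R A] [AddCommGroup B] [Module R B] (hN : IsWModule R N)
    (T : A →ₗ[R] B) (hT : ∀ b, ∃ J : Ideal R, IsGVIdeal R J ∧ ∀ j ∈ J, ∃ a, T a = j • b)
    (θ : A →ₗ[R] N) (hθ : ∀ a, T a = 0 → θ a = 0) : ∃ ψ : B →ₗ[R] N, ψ ∘ₗ T = θ := by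
  rw [isWModule_iff] at hN
  obtain ⟨θ', hθ'⟩ := exists_lift_range T θ hθ
  let rel : B → N → Prop := fun b y =>
    ∃ J : Ideal R, IsGVIdeal R J ∧ ∀ j ∈ J, ∃ a, T a = j • b ∧ θ a = j • y
  have hex : ∀ b, ∃ y, rel b y := fun b => by
    obtain ⟨J, hJ, hb⟩ := hT b
    obtain ⟨y, hy⟩ := hN.2 J hJ
      (θ' ∘ₗ (LinearMap.toSpanSingleton R B b ∘ₗ J.subtype).codRestrict _ fun j => hb j j.2)
    refine ⟨y, J, hJ, fun j hj => ?_⟩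
    obtain ⟨a, ha⟩ := hb j hj
    refine ⟨a, ha, ?_⟩
    rw [← hθ', ← hy ⟨j, hj⟩]
    exact congrArg θ' (Subtype.ext ha)
  have huniq : ∀ b y z, rel b y → rel b z → y = z := by
    rintro b y z ⟨J, hJ, hy⟩ ⟨K, hK, hz⟩
    refine sub_eq_zero.mp (hN.1 _ ⟨J * K, hJ.mul hK, fun j hj => ?_⟩)
    obtain ⟨a, ha, hay⟩ := hy j (Ideal.mul_le_left hj)
    obtain ⟨c, hc, hcz⟩ := hz j (Ideal.mul_le_right hj)
    rw [smul_sub, ← hay, ← hcz, ← map_sub]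
    exact hθ _ (by rw [map_sub, ha, hc, sub_self])
  choose ψ hψ using hex
  refine ⟨{ toFun := ψ, map_add' := fun b c => ?_, map_smul' := fun r b => ?_ }, ?_⟩
  · refine huniq _ _ _ (hψ _) ?_
    obtain ⟨J, hJ, hy⟩ := hψ b
    obtain ⟨K, hK, hz⟩ := hψ c
    refine ⟨J * K, hJ.mul hK, fun j hj => ?_⟩
    obtain ⟨a, ha, hay⟩ := hy j (Ideal.mul_le_left hj)
    obtain ⟨d, hd, hdz⟩ := hz j (Ideal.mul_le_right hj)
    exact ⟨a + d, by rw [map_add, ha, hd, smul_add], by rw [map_add, hay, hdz, smul_add]⟩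
  · refine huniq _ _ _ (hψ _) ?_
    obtain ⟨J, hJ, hy⟩ := hψ b
    refine ⟨J, hJ, fun j hj => ?_⟩
    obtain ⟨a, ha, hay⟩ := hy j hj
    exact ⟨r • a, by rw [map_smul, ha, smul_comm],
      by rw [map_smul, hay, RingHom.id_apply, smul_comm]⟩
  · ext a
    exact huniq _ _ _ (hψ _) ⟨⊤, isGVIdeal_top, fun j _ => ⟨j • a, by simp, by simp⟩⟩

end WModules

section Localization

variable {R : Type*} [CommRing R] (S : Submonoid R) {A B C A' B' C' : Type*}
  [AddCommGroup A] [Module R A] [AddCommGroup B] [Module R B] [AddCommGroup C] [Module R C]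
  [AddCommGroup A'] [Module R A'] [AddCommGroup B'] [Module R B'] [AddCommGroup C'] [Module R C']
  (α : A →ₗ[R] A') (β : B →ₗ[R] B') (γ : C →ₗ[R] C') [IsLocalizedModule S α]
  [IsLocalizedModule S β] [IsLocalizedModule S γ] (f : A →ₗ[R] B) (g : B →ₗ[R] C)

theorem IsLocalizedModule.injective_map_iff :
    Function.Injective (IsLocalizedModule.map S α β f) ↔
      ∀ x, f x = 0 → ∃ s ∈ S, s • x = 0 := by
  rw [injective_iff_map_eq_zero]
  constructor
  · intro h x hx
    have := h (α x) (by rw [IsLocalizedModule.map_apply, hx, map_zero])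
    obtain ⟨s, hs⟩ := (IsLocalizedModule.eq_zero_iff S α).mp this
    exact ⟨s, s.2, hs⟩
  · intro h y hy
    obtain ⟨⟨x, s⟩, rfl⟩ := IsLocalizedModule.mk'_surjective S α y
    rw [Function.uncurry_apply_pair] at hy ⊢
    rw [IsLocalizedModule.map_mk', IsLocalizedModule.mk'_eq_zero,
      IsLocalizedModule.eq_zero_iff S β] at hy
    obtain ⟨t, ht⟩ := hy
    rw [Submonoid.smul_def, ← map_smul] at ht
    obtain ⟨u, hu, hux⟩ := h _ ht
    rw [IsLocalizedModule.mk'_eq_zero, IsLocalizedModule.eq_zero_iff S α]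
    exact ⟨⟨u, hu⟩ * t, by rwa [mul_smul]⟩

theorem IsLocalizedModule.surjective_map_iff :
    Function.Surjective (IsLocalizedModule.map S α β f) ↔
      ∀ y, ∃ s ∈ S, ∃ x, f x = s • y := by
  constructor
  · intro h y
    obtain ⟨z, hz⟩ := h (β y)
    obtain ⟨⟨x, s⟩, rfl⟩ := IsLocalizedModule.mk'_surjective S α z
    rw [Function.uncurry_apply_pair, IsLocalizedModule.map_mk', IsLocalizedModule.mk'_eq_iff,
      Submonoid.smul_def, ← map_smul, IsLocalizedModule.eq_iff_exists S β] at hz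
    obtain ⟨t, ht⟩ := hz
    exact ⟨t * s, mul_mem t.2 s.2, (t : R) • x, by rw [map_smul, mul_smul]; exact ht⟩
  · intro h z
    obtain ⟨⟨y, s⟩, rfl⟩ := IsLocalizedModule.mk'_surjective S β z
    obtain ⟨t, ht, x, hx⟩ := h y
    refine ⟨IsLocalizedModule.mk' α x (⟨t, ht⟩ * s), ?_⟩
    rw [IsLocalizedModule.map_mk', hx]
    exact IsLocalizedModule.mk'_cancel_left (m := y) β ⟨t, ht⟩ s

theorem IsLocalizedModule.exact_map_iff :
    Function.Exact (IsLocalizedModule.map S α β f) (IsLocalizedModule.map S β γ g) ↔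
      (∀ x, ∃ s ∈ S, s • g (f x) = 0) ∧ ∀ y, g y = 0 → ∃ s ∈ S, ∃ x, f x = s • y := by
  constructor
  · intro h
    refine ⟨fun x => ?_, fun y hy => ?_⟩
    · have := h.apply_apply_eq_zero (α x)
      rw [IsLocalizedModule.map_apply, IsLocalizedModule.map_apply] at this
      obtain ⟨s, hs⟩ := (IsLocalizedModule.eq_zero_iff S γ).mp this
      exact ⟨s, s.2, hs⟩
    · obtain ⟨z, hz⟩ := (h (β y)).mp (by rw [IsLocalizedModule.map_apply, hy, map_zero])
      obtain ⟨⟨x, s⟩, rfl⟩ := IsLocalizedModule.mk'_surjective S α z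
      rw [Function.uncurry_apply_pair, IsLocalizedModule.map_mk', IsLocalizedModule.mk'_eq_iff,
        Submonoid.smul_def, ← map_smul, IsLocalizedModule.eq_iff_exists S β] at hz
      obtain ⟨t, ht⟩ := hz
      exact ⟨t * s, mul_mem t.2 s.2, (t : R) • x, by rw [map_smul, mul_smul]; exact ht⟩
  · rintro ⟨h₁, h₂⟩ z
    constructor
    · intro hz
      obtain ⟨⟨y, s⟩, rfl⟩ := IsLocalizedModule.mk'_surjective S β z
      rw [Function.uncurry_apply_pair, IsLocalizedModule.map_mk', IsLocalizedModule.mk'_eq_zero,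
        IsLocalizedModule.eq_zero_iff S γ] at hz
      obtain ⟨t, ht⟩ := hz
      rw [Submonoid.smul_def, ← map_smul] at ht
      obtain ⟨u, hu, x, hx⟩ := h₂ _ ht
      refine ⟨IsLocalizedModule.mk' α x (⟨u, hu⟩ * t * s), ?_⟩
      have hx' : f x = (⟨u, hu⟩ * t : S) • y := by rw [hx, smul_smul]; rfl
      rw [IsLocalizedModule.map_mk', hx', IsLocalizedModule.mk'_cancel_left]
      rfl
    · rintro ⟨w, rfl⟩
      obtain ⟨⟨x, s⟩, rfl⟩ := IsLocalizedModule.mk'_surjective S α w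
      rw [Function.uncurry_apply_pair, IsLocalizedModule.map_mk', IsLocalizedModule.map_mk',
        IsLocalizedModule.mk'_eq_zero, IsLocalizedModule.eq_zero_iff S γ]
      obtain ⟨t, ht, htx⟩ := h₁ x
      exact ⟨⟨t, ht⟩, htx⟩

instance isLocalizedModule_rTensor (M : Type*) [AddCommGroup M] [Module R M] :
    IsLocalizedModule S (α.rTensor M) :=
  inferInstanceAs (IsLocalizedModule S (TensorProduct.AlgebraTensorModule.rTensor R M α))

instance isLocalizedModule_lTensor (M : Type*) [AddCommGroup M] [Module R M] :
    IsLocalizedModule S (α.lTensor M) := by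
  have : α.lTensor M = ((TensorProduct.comm R A' M).toLinearMap ∘ₗ α.rTensor M) ∘ₗ
      (TensorProduct.comm R M A).toLinearMap := by
    ext; simp
  rw [this]
  infer_instance

theorem map_rTensor_eq (M : Type*) [AddCommGroup M] [Module R M] :
    IsLocalizedModule.map S (α.rTensor M) (β.rTensor M) (f.rTensor M) =
      (IsLocalizedModule.map S α β f).rTensor M := by
  apply IsLocalizedModule.linearMap_ext S (α.rTensor M) (β.rTensor M)
  rw [IsLocalizedModule.map_comp]
  ext
  simp

end Localization

section Flatness

variable {R : Type*} [CommRing R] {A B C K F X : Type*}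
  [AddCommGroup A] [Module R A] [AddCommGroup B] [Module R B] [AddCommGroup C] [Module R C]
  [AddCommGroup K] [Module R K] [AddCommGroup F] [Module R F] [AddCommGroup X] [Module R X]

theorem rTensor_injective_of_lTensor_injective {f : A →ₗ[R] B} {g : B →ₗ[R] C} {i : K →ₗ[R] F}
    {q : F →ₗ[R] X} (hfg : Function.Exact f g) (hg : Function.Surjective g)
    (hiq : Function.Exact i q) (hq : Function.Surjective q)
    (hC : Function.Injective (i.lTensor C)) (hF : Function.Injective (f.rTensor F)) :
    Function.Injective (f.rTensor X) := by
  rw [injective_iff_map_eq_zero]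
  intro x hx
  obtain ⟨a, rfl⟩ := LinearMap.lTensor_surjective A hq x
  rw [← LinearMap.comp_apply, LinearMap.rTensor_comp_lTensor, ← LinearMap.lTensor_comp_rTensor,
    LinearMap.comp_apply] at hx
  obtain ⟨b, hb⟩ := (lTensor_exact B hiq hq _).mp hx
  have hb0 : i.lTensor C (g.rTensor K b) = 0 := by
    rw [← LinearMap.comp_apply, LinearMap.lTensor_comp_rTensor, ← LinearMap.rTensor_comp_lTensor,
      LinearMap.comp_apply, hb, ← LinearMap.comp_apply, ← LinearMap.rTensor_comp,
      hfg.linearMap_comp_eq_zero, LinearMap.rTensor_zero, LinearMap.zero_apply]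
  obtain ⟨a', rfl⟩ := (rTensor_exact K hfg hg _).mp ((map_eq_zero_iff _ hC).mp hb0)
  rw [← LinearMap.comp_apply, LinearMap.lTensor_comp_rTensor, ← LinearMap.rTensor_comp_lTensor,
    LinearMap.comp_apply] at hb
  rw [← hF hb]
  exact (lTensor_exact A hiq hq).apply_apply_eq_zero a'

theorem rTensor_injective_of_flat {f : A →ₗ[R] B} {g : B →ₗ[R] C} (hf : Function.Injective f)
    (hfg : Function.Exact f g) (hg : Function.Surjective g) [Module.Flat R C]
    (X : Type*) [AddCommGroup X] [Module R X] : Function.Injective (f.rTensor X) := by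
  have hq : Function.Surjective (Finsupp.linearCombination R (id : X → X)) :=
    Finsupp.linearCombination_id_surjective R X
  exact rTensor_injective_of_lTensor_injective hfg hg (LinearMap.exact_subtype_ker_map _) hq
    (Module.Flat.lTensor_preserves_injective_linearMap _ (Submodule.injective_subtype _))
    (Module.Flat.rTensor_preserves_injective_linearMap _ hf)

theorem flat_of_rTensor_injective {f : A →ₗ[R] B} {g : B →ₗ[R] C} [Module.Flat R B]
    (hfg : Function.Exact f g) (hg : Function.Surjective g)
    (h : ∀ I : Ideal R, Function.Injective (f.rTensor (R ⧸ I))) : Module.Flat R C := by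
  rw [Module.Flat.iff_rTensor_injective']
  intro I
  refine rTensor_injective_of_lTensor_injective (g := I.mkQ) ?_ I.mkQ_surjective hfg hg ?_ ?_
  · rw [LinearMap.exact_iff, Submodule.ker_mkQ, Submodule.range_subtype]
  · rw [← LinearMap.comm_comp_rTensor_comp_comm_eq]
    simpa using h I
  · exact Module.Flat.rTensor_preserves_injective_linearMap _ (Submodule.injective_subtype _)

theorem flat_of_exact_of_flat {f : A →ₗ[R] B} {g : B →ₗ[R] C} (hf : Function.Injective f)
    (hfg : Function.Exact f g) (hg : Function.Surjective g) [Module.Flat R B] [Module.Flat R C] :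
    Module.Flat R A := by
  rw [Module.Flat.iff_rTensor_injective']
  intro I
  have h : Function.Injective (I.subtype.rTensor B ∘ₗ f.lTensor I) := by
    refine (Module.Flat.rTensor_preserves_injective_linearMap _
      (Submodule.injective_subtype _)).comp ?_
    rw [← LinearMap.comm_comp_rTensor_comp_comm_eq]
    simpa using rTensor_injective_of_flat hf hfg hg I
  rw [LinearMap.rTensor_comp_lTensor, ← LinearMap.lTensor_comp_rTensor] at h
  exact Function.Injective.of_comp (f := f.lTensor R) h

end Flatness

section LocalFlatness

variable {R : Type} [CommRing R] {S : Submonoid R}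

theorem locMap_mk {A B : Type} [AddCommGroup A] [Module R A] [AddCommGroup B] [Module R B]
    (f : A →ₗ[R] B) (a : A) : locMap R S f (LocalizedModule.mkLinearMap S A a) =
      LocalizedModule.mkLinearMap S B (f a) :=
  IsLocalizedModule.map_apply S _ _ f a

theorem ActsBijectively.bijective_of_isLocalizedModule {X Y : Type}
    [AddCommGroup X] [Module R X] [AddCommGroup Y] [Module R Y] (h : ActsBijectively S X)
    (f : X →ₗ[R] Y) [IsLocalizedModule S f] : Function.Bijective f := by
  refine ⟨h.injective_of_isLocalizedModule f, fun y => ?_⟩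
  obtain ⟨⟨x, s⟩, hx⟩ := IsLocalizedModule.surj S f y
  obtain ⟨z, rfl⟩ := (h s s.2).2 x
  refine ⟨z, ((Module.End.isUnit_iff _).mp (IsLocalizedModule.map_units f s)).1 ?_⟩
  change (s : R) • f z = (s : R) • y
  rw [← map_smul]
  exact hx.symm

theorem flat_localizedModule (Q : Type) [AddCommGroup Q] [Module R Q] [Module.Flat R Q] :
    Module.Flat R (LocalizedModule S Q) :=
  (Module.flat_iff_of_isLocalization (Localization S) S (LocalizedModule S Q)).mp inferInstance

variable {K F Q : Type} [AddCommGroup K] [Module R K] [AddCommGroup F] [Module R F]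
  [AddCommGroup Q] [Module R Q]

/-- Tensoring with an `S`-local module does not see the difference between a map and its
localization at `S`. -/
theorem ActsBijectively.injective_rTensor_locMap_iff {X : Type} [AddCommGroup X] [Module R X]
    (h : ActsBijectively S X) (f : K →ₗ[R] F) :
    Function.Injective ((locMap R S f).rTensor X) ↔ Function.Injective (f.rTensor X) := by
  have hK := (h.tensorProduct_right K).bijective_of_isLocalizedModule
    ((LocalizedModule.mkLinearMap S K).rTensor X)
  have hF := (h.tensorProduct_right F).bijective_of_isLocalizedModule
    ((LocalizedModule.mkLinearMap S F).rTensor X)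
  have comm : ⇑((locMap R S f).rTensor X) ∘ ⇑((LocalizedModule.mkLinearMap S K).rTensor X) =
      ⇑((LocalizedModule.mkLinearMap S F).rTensor X) ∘ ⇑(f.rTensor X) := by
    rw [← LinearMap.coe_comp, ← LinearMap.coe_comp, ← LinearMap.rTensor_comp,
      ← LinearMap.rTensor_comp]
    congr 2
    ext a
    exact locMap_mk f a
  rw [← Function.Injective.of_comp_iff' _ hK, comm, Function.Injective.of_comp_iff hF.1]

theorem injective_rTensor_locMap_of_injective {f : K →ₗ[R] F} {X : Type} [AddCommGroup X]
    [Module R X] (h : Function.Injective ((locMap R S f).rTensor (LocalizedModule S X))) :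
    Function.Injective ((locMap R S f).rTensor X) := by
  have hK : Function.Injective
      ((LocalizedModule.mkLinearMap S X).lTensor (LocalizedModule S K)) :=
    ((actsBijectively_localizedModule S K).tensorProduct_left X).injective_of_isLocalizedModule _
  have := h.comp hK
  rw [← LinearMap.coe_comp, LinearMap.rTensor_comp_lTensor, ← LinearMap.lTensor_comp_rTensor,
    LinearMap.coe_comp] at this
  exact this.of_comp

theorem injective_locMap {f : K →ₗ[R] F} (hf : Function.Injective f) :
    Function.Injective (locMap R S f) :=
  IsLocalizedModule.map_injective S _ _ f hf

theorem surjective_locMap {f : K →ₗ[R] F} (hf : Function.Surjective f) :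
    Function.Surjective (locMap R S f) :=
  IsLocalizedModule.map_surjective S _ _ f hf

theorem exact_locMap {f : K →ₗ[R] F} {g : F →ₗ[R] Q} (h : Function.Exact f g) :
    Function.Exact (locMap R S f) (locMap R S g) :=
  IsLocalizedModule.map_exact S _ _ _ f g h

theorem flat_localizedModule_of_injective {f : K →ₗ[R] F} {g : F →ₗ[R] Q} [Module.Flat R F]
    (hfg : Function.Exact (locMap R S f) (locMap R S g))
    (hg : Function.Surjective (locMap R S g))
    (h : ∀ (X : Type) [AddCommGroup X] [Module R X], ActsBijectively S X →
      Function.Injective (f.rTensor X)) : Module.Flat R (LocalizedModule S Q) :=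
  have := flat_localizedModule (S := S) F
  flat_of_rTensor_injective hfg hg fun I =>
    injective_rTensor_locMap_of_injective
      (((actsBijectively_localizedModule S (R ⧸ I)).injective_rTensor_locMap_iff f).mpr
        (h _ (actsBijectively_localizedModule S (R ⧸ I))))

theorem flat_localizedModule_of_exists_extension {p : F →ₗ[R] Q} [Module.Flat R F]
    (hp : Function.Surjective p)
    (h : ∀ (X : Type) [AddCommGroup X] [Module R X], ActsBijectively S X →
      ∀ φ : LinearMap.ker p →ₗ[R] CharacterModule X, ∃ ψ : F →ₗ[R] CharacterModule X,
        ψ ∘ₗ (LinearMap.ker p).subtype = φ) : Module.Flat R (LocalizedModule S Q) :=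
  flat_localizedModule_of_injective (exact_locMap (LinearMap.exact_subtype_ker_map p))
    (surjective_locMap hp) fun X _ _ hX =>
      rTensor_injective_iff_lcomp_surjective.mpr (h X hX)

theorem exists_extension_characterModule {p : F →ₗ[R] Q} (hp : Function.Surjective p)
    [Module.Flat R (LocalizedModule S Q)] {X : Type} [AddCommGroup X] [Module R X]
    (hX : ActsBijectively S X) (φ : LinearMap.ker p →ₗ[R] CharacterModule X) :
    ∃ ψ : F →ₗ[R] CharacterModule X, ψ ∘ₗ (LinearMap.ker p).subtype = φ :=
  rTensor_injective_iff_lcomp_surjective.mp ((hX.injective_rTensor_locMap_iff _).mp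
    (rTensor_injective_of_flat (injective_locMap (LinearMap.ker p).injective_subtype)
      (exact_locMap (LinearMap.exact_subtype_ker_map p)) (surjective_locMap hp) X)) φ

theorem flat_localizedModule_ker {p : F →ₗ[R] Q} [Module.Flat R F]
    (hp : Function.Surjective p) [Module.Flat R (LocalizedModule S Q)] :
    Module.Flat R (LocalizedModule S (LinearMap.ker p)) :=
  have := flat_localizedModule (S := S) F
  flat_of_exact_of_flat (injective_locMap (LinearMap.ker p).injective_subtype)
    (exact_locMap (LinearMap.exact_subtype_ker_map p)) (surjective_locMap hp)

theorem locMap_rTensor_eq (f : K →ₗ[R] F) (M : Type) [AddCommGroup M] [Module R M] :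
    IsLocalizedModule.map S ((LocalizedModule.mkLinearMap S K).rTensor M)
      ((LocalizedModule.mkLinearMap S F).rTensor M) (f.rTensor M) = (locMap R S f).rTensor M :=
  map_rTensor_eq S _ _ f M

theorem injective_locMap_rTensor_iff (f : K →ₗ[R] F) (M : Type) [AddCommGroup M] [Module R M] :
    Function.Injective (locMap R S (f.rTensor M)) ↔
      Function.Injective ((locMap R S f).rTensor M) := by
  rw [← locMap_rTensor_eq, IsLocalizedModule.injective_map_iff, locMap,
    IsLocalizedModule.injective_map_iff]

theorem surjective_locMap_rTensor_iff (f : K →ₗ[R] F) (M : Type) [AddCommGroup M]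
    [Module R M] : Function.Surjective (locMap R S (f.rTensor M)) ↔
      Function.Surjective ((locMap R S f).rTensor M) := by
  rw [← locMap_rTensor_eq, IsLocalizedModule.surjective_map_iff, locMap,
    IsLocalizedModule.surjective_map_iff]

theorem exact_locMap_rTensor_iff (f : K →ₗ[R] F) (g : F →ₗ[R] Q) (M : Type) [AddCommGroup M]
    [Module R M] : Function.Exact (locMap R S (f.rTensor M)) (locMap R S (g.rTensor M)) ↔
      Function.Exact ((locMap R S f).rTensor M) ((locMap R S g).rTensor M) := by
  rw [← locMap_rTensor_eq, ← locMap_rTensor_eq, IsLocalizedModule.exact_map_iff, locMap, locMap,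
    IsLocalizedModule.exact_map_iff]

end LocalFlatness

section DaggerClass

variable {R : Type} [CommRing R]

theorem exists_flat_cosyzygy {S : Submonoid R} {M : Type} [AddCommGroup M] [Module R M]
    [Module.Flat R (LocalizedModule S M)] (P : ProjectiveResolution (ModuleCat.of R M)) (n : ℕ) :
    ∃ (Q : Type) (_ : AddCommGroup Q) (_ : Module R Q) (p : P.complex.X n →ₗ[R] Q),
      Function.Surjective p ∧ Function.Exact (P.complex.d (n + 1) n).hom p ∧
        Module.Flat R (LocalizedModule S Q) := by
  induction n with
  | zero =>
    exact ⟨M, _, _, resolutionAugmentation P, resolutionAugmentation_surjective P,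
      exact_resolutionAugmentation P, inferInstance⟩
  | succ n ih =>
    obtain ⟨Q, _, _, p, hp, hdp, hQ⟩ := ih
    refine ⟨LinearMap.ker p, _, _,
      (P.complex.d (n + 1) n).hom.codRestrict _ hdp.apply_apply_eq_zero, ?_, ?_,
      flat_localizedModule_ker hp⟩
    · rintro ⟨x, hx⟩
      obtain ⟨y, rfl⟩ := (hdp x).mp hx
      exact ⟨y, rfl⟩
    · exact fun x => (Subtype.ext_iff).trans (exact_complex_d P n x)

theorem subsingleton_extM_characterModule {S : Submonoid R} {M X : Type} [AddCommGroup M]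
    [Module R M] [Module.Flat R (LocalizedModule S M)] [AddCommGroup X] [Module R X]
    (hX : ActsBijectively S X) (n : ℕ) :
    Subsingleton (extM R M (CharacterModule X) (n + 1)) := by
  let P := projectiveResolution (ModuleCat.of R M)
  obtain ⟨Φ, hΦ, hΦ0⟩ := exists_cocycles_surjection_ext M (CharacterModule X) P n
  refine subsingleton_of_forall_eq 0 fun e => ?_
  obtain ⟨⟨φ, hφ⟩, rfl⟩ := hΦ e
  obtain ⟨Q, _, _, p, hp, hdp, hQ⟩ := exists_flat_cosyzygy (S := S) P n
  obtain ⟨φ', hφ'⟩ := exists_lift_range (P.complex.d (n + 1) n).hom φ fun a ha => by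
    obtain ⟨b, rfl⟩ := (exact_complex_d P n a).mp ha
    exact congr($hφ b)
  obtain ⟨ψ, hψ⟩ := exists_extension_characterModule hp hX
    (φ' ∘ₗ (LinearEquiv.ofEq _ _ (LinearMap.exact_iff.mp hdp)).toLinearMap)
  refine (hΦ0 _).mpr ⟨ψ, LinearMap.ext fun a => ?_⟩
  rw [← hφ' a]
  exact congr($hψ ⟨_, hdp.apply_apply_eq_zero a⟩)

/-- The elements of `B` some GV-multiple of which lies in the range of `T`. -/
def gvClosure {A B : Type} [AddCommGroup A] [Module R A] [AddCommGroup B] [Module R B]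
    (T : A →ₗ[R] B) : Submodule R B where
  carrier := {b | ∃ J : Ideal R, IsGVIdeal R J ∧ ∀ j ∈ J, ∃ a, T a = j • b}
  zero_mem' := ⟨⊤, isGVIdeal_top, fun j _ => ⟨0, by simp⟩⟩
  add_mem' := by
    rintro x y ⟨J, hJ, hx⟩ ⟨K, hK, hy⟩
    refine ⟨J * K, hJ.mul hK, fun j hj => ?_⟩
    obtain ⟨a, ha⟩ := hx j (Ideal.mul_le_left hj)
    obtain ⟨b, hb⟩ := hy j (Ideal.mul_le_right hj)
    exact ⟨a + b, by rw [map_add, ha, hb, smul_add]⟩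
  smul_mem' := by
    rintro c x ⟨J, hJ, hx⟩
    refine ⟨J, hJ, fun j hj => ?_⟩
    obtain ⟨a, ha⟩ := hx j hj
    exact ⟨c • a, by rw [map_smul, ha, smul_comm]⟩

theorem mem_gvClosure_of_isGVIdeal {A B : Type} [AddCommGroup A] [Module R A] [AddCommGroup B]
    [Module R B] {T : A →ₗ[R] B} {J : Ideal R} (hJ : IsGVIdeal R J) {b : B}
    (h : ∀ j ∈ J, j • b ∈ gvClosure T) : b ∈ gvClosure T := by
  let I : Ideal R := (LinearMap.range T).comap (LinearMap.toSpanSingleton R B b)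
  obtain ⟨K, hK, hb⟩ := isWIdeal_wClosure I 1 ⟨J, hJ, fun j hj => by
    obtain ⟨K, hK, hb⟩ := h j hj
    refine ⟨K, hK, fun k hk => ?_⟩
    obtain ⟨a, ha⟩ := hb k hk
    exact ⟨a, by simp [ha, mul_smul]⟩⟩
  refine ⟨K, hK, fun k hk => ?_⟩
  obtain ⟨a, ha⟩ := hb k hk
  exact ⟨a, by simpa using ha⟩

theorem isWModule_gvClosure {A B : Type} [AddCommGroup A] [Module R A] [AddCommGroup B]
    [Module R B] (hB : IsWModule R B) (T : A →ₗ[R] B) : IsWModule R (gvClosure T) := by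
  rw [isWModule_iff] at hB ⊢
  refine ⟨?_, fun J hJ φ => ?_⟩
  · rintro x ⟨J, hJ, hx⟩
    exact Subtype.ext (hB.1 x ⟨J, hJ, fun j hj => congrArg Subtype.val (hx j hj)⟩)
  · obtain ⟨y, hy⟩ := hB.2 J hJ ((gvClosure T).subtype ∘ₗ φ)
    exact ⟨⟨y, mem_gvClosure_of_isGVIdeal hJ fun j hj => hy ⟨j, hj⟩ ▸ (φ ⟨j, hj⟩).2⟩,
      fun j => Subtype.ext (hy j)⟩

theorem isWModule_pi {ι : Type} {X : ι → Type} [∀ i, AddCommGroup (X i)] [∀ i, Module R (X i)]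
    (h : ∀ i, IsWModule R (X i)) : IsWModule R (∀ i, X i) := by
  simp_rw [isWModule_iff] at h ⊢
  refine ⟨?_, fun J hJ φ => ?_⟩
  · rintro x ⟨J, hJ, hx⟩
    exact funext fun i => (h i).1 _ ⟨J, hJ, fun j hj => congrFun (hx j hj) i⟩
  · choose y hy using fun i => (h i).2 J hJ (LinearMap.proj i ∘ₗ φ)
    exact ⟨y, fun j => funext fun i => hy i j⟩

variable (R) in
/-- The product of the localizations of `M` at the maximal `w`-ideals. -/
abbrev LocalizationsProduct (M : Type) [AddCommGroup M] [Module R M] : Type :=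
  ∀ x : {x : PrimeSpectrum R // IsMaxWIdeal R x.asIdeal},
    LocalizedModule x.1.asIdeal.primeCompl M

variable (R) in
/-- The canonical map into the product of the localizations at the maximal `w`-ideals. -/
noncomputable def toLocalizationsProduct (M : Type) [AddCommGroup M] [Module R M] :
    M →ₗ[R] LocalizationsProduct R M :=
  LinearMap.pi fun x => LocalizedModule.mkLinearMap x.1.asIdeal.primeCompl M

theorem exists_isGVIdeal_smul_eq_zero {M : Type} [AddCommGroup M] [Module R M] {m : M}
    (h : ∀ P : Ideal R, IsMaxWIdeal R P → ∀ [P.IsPrime], ∃ s ∈ P.primeCompl, s • m = 0) :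
    ∃ J : Ideal R, IsGVIdeal R J ∧ ∀ j ∈ J, j • m = 0 := by
  obtain ⟨J, hJ, hJm⟩ := exists_isGVIdeal_le (I := LinearMap.ker (LinearMap.toSpanSingleton R M m))
    fun P hP _ => by simpa using h P hP
  exact ⟨J, hJ, fun j hj => by simpa using hJm hj⟩

theorem isWModule_localizationsProduct (M : Type) [AddCommGroup M] [Module R M] :
    IsWModule R (LocalizationsProduct R M) :=
  isWModule_pi fun x => (actsBijectively_localizedModule _ M).isWModule x.2

theorem exists_isGVIdeal_of_toLocalizationsProduct_eq_zero {M : Type} [AddCommGroup M]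
    [Module R M] {m : M} (hm : toLocalizationsProduct R M m = 0) :
    ∃ J : Ideal R, IsGVIdeal R J ∧ ∀ j ∈ J, j • m = 0 := by
  refine exists_isGVIdeal_smul_eq_zero fun P hP _ => ?_
  obtain ⟨s, hs⟩ := (IsLocalizedModule.eq_zero_iff P.primeCompl
    (LocalizedModule.mkLinearMap P.primeCompl M)).mp (congrFun hm ⟨⟨P, ‹_›⟩, hP⟩)
  exact ⟨s, s.2, hs⟩

theorem ker_toLocalizationsProduct (M : Type) [AddCommGroup M] [Module R M] :
    LinearMap.ker (toLocalizationsProduct R M) = torGV R M := by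
  refine le_antisymm (fun m hm => ?_) (Submodule.span_le.mpr ?_)
  · exact Submodule.subset_span (exists_isGVIdeal_of_toLocalizationsProduct_eq_zero hm)
  · rintro m ⟨J, hJ, hm⟩
    exact (isWModule_localizationsProduct M).1 _ ⟨J, hJ, fun j hj => by
      rw [← map_smul, hm j hj, map_zero]⟩

theorem exists_isWEnvelope (M : Type) [AddCommGroup M] [Module R M] :
    ∃ (L : Type) (_ : AddCommGroup L) (_ : Module R L) (ι : (M ⧸ torGV R M) →ₗ[R] L),
      IsWEnvelope R (M ⧸ torGV R M) L ι := by
  let τ := (toLocalizationsProduct R M).codRestrict (gvClosure (toLocalizationsProduct R M))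
    fun m => ⟨⊤, isGVIdeal_top, fun j _ => ⟨j • m, map_smul _ _ _⟩⟩
  have hτ : LinearMap.ker τ = torGV R M :=
    (LinearMap.ker_codRestrict _ _ _).trans (ker_toLocalizationsProduct M)
  refine ⟨gvClosure (toLocalizationsProduct R M), inferInstance, inferInstance,
    (torGV R M).liftQ τ hτ.ge, isWModule_gvClosure (isWModule_localizationsProduct M) _, ?_, ?_⟩
  · rw [← LinearMap.ker_eq_bot]
    exact Submodule.ker_liftQ_eq_bot _ _ _ hτ.le
  · intro x
    obtain ⟨⟨y, J, hJ, hy⟩, rfl⟩ := Submodule.mkQ_surjective _ x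
    refine ⟨J, hJ, fun j hj => ?_⟩
    obtain ⟨a, ha⟩ := hy j hj
    rw [← map_smul, Submodule.mkQ_apply, Submodule.Quotient.mk_eq_zero]
    exact ⟨(torGV R M).mkQ a, Subtype.ext ha⟩

theorem IsWEnvelope.exists_isGVIdeal {M L : Type} [AddCommGroup M] [Module R M] [AddCommGroup L]
    [Module R L] {ι : M →ₗ[R] L} (h : IsWEnvelope R M L ι) (l : L) :
    ∃ J : Ideal R, IsGVIdeal R J ∧ ∀ j ∈ J, ∃ m, ι m = j • l := by
  obtain ⟨J, hJ, hl⟩ := h.2.2 (Submodule.mkQ _ l)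
  refine ⟨J, hJ, fun j hj => ?_⟩
  have := hl j hj
  rwa [← map_smul, Submodule.mkQ_apply, Submodule.Quotient.mk_eq_zero] at this

theorem exists_isGVIdeal_of_mem_torGV {M : Type} [AddCommGroup M] [Module R M] {m : M}
    (hm : m ∈ torGV R M) : ∃ J : Ideal R, IsGVIdeal R J ∧ ∀ j ∈ J, j • m = 0 :=
  exists_isGVIdeal_of_toLocalizationsProduct_eq_zero (by
    rwa [← ker_toLocalizationsProduct] at hm)

/-- A `w`-envelope of `M / tor_GV(M)` has the same localizations at maximal `w`-ideals as `M`. -/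
theorem IsWEnvelope.bijective_locMap {M L : Type} [AddCommGroup M] [Module R M] [AddCommGroup L]
    [Module R L] {ι : (M ⧸ torGV R M) →ₗ[R] L} (h : IsWEnvelope R (M ⧸ torGV R M) L ι)
    {P : Ideal R} [P.IsPrime] (hP : IsMaxWIdeal R P) :
    Function.Bijective (locMap R P.primeCompl (ι ∘ₗ (torGV R M).mkQ)) := by
  refine ⟨(IsLocalizedModule.injective_map_iff _ _ _ _).mpr fun m hm => ?_,
    (IsLocalizedModule.surjective_map_iff _ _ _ _).mpr fun l => ?_⟩
  · have hm' : m ∈ torGV R M := by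
      rw [LinearMap.comp_apply, map_eq_zero_iff ι h.2.1] at hm
      simpa using hm
    obtain ⟨J, hJ, hJm⟩ := exists_isGVIdeal_of_mem_torGV hm'
    obtain ⟨s, hs, hsJ⟩ := hP.exists_mem_primeCompl hJ
    exact ⟨s, hs, hJm s hsJ⟩
  · obtain ⟨J, hJ, hJl⟩ := h.exists_isGVIdeal l
    obtain ⟨s, hs, hsJ⟩ := hP.exists_mem_primeCompl hJ
    obtain ⟨m, hm⟩ := hJl s hsJ
    obtain ⟨m, rfl⟩ := Submodule.mkQ_surjective _ m
    exact ⟨s, hs, m, hm⟩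

theorem ActsBijectively.exists_extension_of_isGVTorsion {P : Ideal R} [P.IsPrime]
    (hP : IsMaxWIdeal R P) {F L N : Type} [AddCommGroup F] [Module R F] [AddCommGroup L]
    [Module R L] [AddCommGroup N] [Module R N] (hN : ActsBijectively P.primeCompl N)
    [Module.Projective R F] {p : F →ₗ[R] L} (hp : Function.Surjective p)
    (h : IsGVTorsion R (extM R L N 1)) (φ : LinearMap.ker p →ₗ[R] N) :
    ∃ ψ : F →ₗ[R] N, ψ ∘ₗ (LinearMap.ker p).subtype = φ := by
  obtain ⟨Φ, -, hΦ⟩ := exists_ker_surjection_ext (N := N) p hp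
  obtain ⟨J, hJ, hJφ⟩ := h (Φ φ)
  obtain ⟨s, hs, hsJ⟩ := hP.exists_mem_primeCompl hJ
  obtain ⟨ψ, hψ⟩ := (hΦ (s • φ)).mp (by rw [map_smul, hJφ s hsJ])
  let e := LinearEquiv.ofBijective (LinearMap.lsmul R N s) (hN s hs)
  refine ⟨e.symm.toLinearMap ∘ₗ ψ, LinearMap.ext fun x => ?_⟩
  exact (e.symm_apply_eq).mpr congr($hψ x)

theorem IsWProjective.flat_localizedModule {M : Type} [AddCommGroup M] [Module R M]
    (hM : IsWProjective R M) {P : Ideal R} [P.IsPrime] (hP : IsMaxWIdeal R P) :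
    Module.Flat R (LocalizedModule P.primeCompl M) := by
  obtain ⟨L, _, _, ι, hι⟩ := exists_isWEnvelope (R := R) M
  have hL : Module.Flat R (LocalizedModule P.primeCompl L) :=
    flat_localizedModule_of_exists_extension (Finsupp.linearCombination_id_surjective R L)
      fun X _ _ hX => hX.characterModule.exists_extension_of_isGVTorsion hP
        (Finsupp.linearCombination_id_surjective R L)
        (hM _ (hX.characterModule.isGVTorsionFree hP) (hX.characterModule.isWModule hP) L ι hι)
  exact .of_linearEquiv (LinearEquiv.ofBijective _ (hι.bijective_locMap hP))

theorem memPwDaggerInfty_characterModule {P : Ideal R} [P.IsPrime] (hP : IsMaxWIdeal R P)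
    {X : Type} [AddCommGroup X] [Module R X] (hX : ActsBijectively P.primeCompl X) :
    MemPwDaggerInfty R (CharacterModule X) := by
  refine ⟨hX.characterModule.isGVTorsionFree hP, fun M _ _ hM k hk => ?_⟩
  obtain ⟨n, rfl⟩ := Nat.exists_eq_add_of_le' hk
  have := hM.flat_localizedModule hP
  exact subsingleton_extM_characterModule hX n

theorem IsWeakWProjective.flat_localizedModule {C : Type} [AddCommGroup C] [Module R C]
    (hC : IsWeakWProjective R C) {P : Ideal R} [P.IsPrime] (hP : IsMaxWIdeal R P) :
    Module.Flat R (LocalizedModule P.primeCompl C) := by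
  refine flat_localizedModule_of_exists_extension (Finsupp.linearCombination_id_surjective R C)
    fun X _ _ hX φ => ?_
  obtain ⟨Φ, -, hΦ⟩ := exists_ker_surjection_ext (N := CharacterModule X) _
    (Finsupp.linearCombination_id_surjective R C)
  have := hC _ (memPwDaggerInfty_characterModule hP hX)
  exact (hΦ φ).mp (Subsingleton.elim _ _)

end DaggerClass

section FinitelyPresentedType

variable {R : Type} [CommRing R]

theorem exists_isGVIdeal_smul_mem_range {A B : Type} [AddCommGroup A] [Module R A]
    [AddCommGroup B] [Module R B] {T : A →ₗ[R] B} (hT : IsWEpi R T) (b : B) :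
    ∃ J : Ideal R, IsGVIdeal R J ∧ ∀ j ∈ J, ∃ a, T a = j • b := by
  obtain ⟨J, hJ, hJb⟩ := exists_isGVIdeal_le
    (I := (LinearMap.range T).comap (LinearMap.toSpanSingleton R B b)) fun P hP _ => by
      obtain ⟨s, hs, a, ha⟩ := (IsLocalizedModule.surjective_map_iff _ _ _ _).mp (hT P hP) b
      exact ⟨s, hs, a, by simpa using ha⟩
  refine ⟨J, hJ, fun j hj => ?_⟩
  obtain ⟨a, ha⟩ := hJb hj
  exact ⟨a, by simpa using ha⟩

theorem IsGVTorsionFree.eq_zero {M : Type} [AddCommGroup M] [Module R M]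
    (hM : IsGVTorsionFree R M) {x : M}
    (h : ∀ P : Ideal R, IsMaxWIdeal R P → ∀ [P.IsPrime], ∃ s ∈ P.primeCompl, s • x = 0) :
    x = 0 :=
  hM x (exists_isGVIdeal_smul_eq_zero h)

/-- The scalars acting on the cokernel of `f` through maps factoring over `B`. -/
def liftableScalars {A B : Type} [AddCommGroup A] [Module R A] [AddCommGroup B] [Module R B]
    (f : A →ₗ[R] B) : Ideal R where
  carrier := {s | ∃ σ : B →ₗ[R] B, σ ∘ₗ f = 0 ∧ ∀ x, s • x - σ x ∈ LinearMap.range f}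
  zero_mem' := ⟨0, by simp, by simp⟩
  add_mem' := by
    rintro s t ⟨σ, hσ, hs⟩ ⟨τ, hτ, ht⟩
    refine ⟨σ + τ, by rw [LinearMap.add_comp, hσ, hτ, add_zero], fun x => ?_⟩
    rw [add_smul, LinearMap.add_apply, add_sub_add_comm]
    exact add_mem (hs x) (ht x)
  smul_mem' := by
    rintro c s ⟨σ, hσ, hs⟩
    refine ⟨c • σ, by rw [LinearMap.smul_comp, hσ, smul_zero], fun x => ?_⟩
    rw [smul_eq_mul, mul_smul, LinearMap.smul_apply, ← smul_sub]
    exact Submodule.smul_mem _ _ (hs x)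

theorem exists_mem_liftableScalars {A B L : Type} [AddCommGroup A] [Module R A] [Module.Finite R A]
    [AddCommGroup B] [Module R B] [Module.Free R B] [Module.Finite R B] [AddCommGroup L]
    [Module R L] {S : Submonoid R} [Module.Flat R (LocalizedModule S L)]
    {f : A →ₗ[R] B} {u : B →ₗ[R] L} (hfu : u ∘ₗ f = 0)
    (hexact : Function.Exact (locMap R S f) (locMap R S u))
    (hu : Function.Surjective (locMap R S u)) : ∃ s ∈ S, s ∈ liftableScalars f := by
  let q := (LinearMap.range f).mkQ
  have hq : Function.Surjective q := Submodule.mkQ_surjective _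
  have : Module.FinitePresentation R (B ⧸ LinearMap.range f) :=
    Module.finitePresentation_of_free_of_surjective q hq
      (by rw [Submodule.ker_mkQ]; exact Submodule.fg_range f)
  let v : (B ⧸ LinearMap.range f) →ₗ[R] L := (LinearMap.range f).liftQ u (by
    rintro _ ⟨a, rfl⟩
    exact congr($hfu a))
  have hv : Function.Bijective (locMap R S v) := by
    refine ⟨(IsLocalizedModule.injective_map_iff _ _ _ _).mpr fun d hd => ?_,
      (IsLocalizedModule.surjective_map_iff _ _ _ _).mpr fun l => ?_⟩
    · obtain ⟨x, rfl⟩ := hq d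
      obtain ⟨s, hs, a, ha⟩ := ((IsLocalizedModule.exact_map_iff _ _ _ _ _ _).mp hexact).2 x hd
      refine ⟨s, hs, ?_⟩
      rw [← map_smul, ← ha]
      exact (Submodule.Quotient.mk_eq_zero _).mpr ⟨a, rfl⟩
    · obtain ⟨s, hs, x, hx⟩ := (IsLocalizedModule.surjective_map_iff _ _ _ _).mp hu l
      exact ⟨s, hs, q x, hx⟩
  have : Module.Flat R (LocalizedModule S (B ⧸ LinearMap.range f)) :=
    .of_linearEquiv (LinearEquiv.ofBijective _ hv)
  obtain ⟨k, h₂, h₃, h⟩ := Module.Flat.exists_factorization_of_finitePresentation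
    (LocalizedModule.mkLinearMap S (B ⧸ LinearMap.range f))
  obtain ⟨h₃', s, hs⟩ := Module.FinitePresentation.exists_lift_of_isLocalizedModule S
    (LocalizedModule.mkLinearMap S (B ⧸ LinearMap.range f)) h₃
  obtain ⟨t, ht⟩ := Module.Finite.exists_smul_of_comp_eq_of_isLocalizedModule S
    (LocalizedModule.mkLinearMap S (B ⧸ LinearMap.range f)) (s • LinearMap.id) (h₃' ∘ₗ h₂) (by
      rw [← LinearMap.comp_assoc, hs, LinearMap.smul_comp, ← h]
      ext
      simp)
  obtain ⟨ρ, hρ⟩ := Module.projective_lifting_property q (t • h₃') hq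
  refine ⟨t * s, mul_mem t.2 s.2, ρ ∘ₗ h₂ ∘ₗ q, ?_, fun x => ?_⟩
  · ext a
    have : q (f a) = 0 := (Submodule.Quotient.mk_eq_zero _).mpr ⟨a, rfl⟩
    simp [this]
  · rw [← Submodule.Quotient.mk_eq_zero, ← Submodule.mkQ_apply]
    change q _ = 0
    have h₁ : q (ρ (h₂ (q x))) = t • h₃' (h₂ (q x)) := congr($hρ (h₂ (q x)))
    have h₄ : t • s • q x = t • h₃' (h₂ (q x)) := congr($ht (q x))
    rw [map_sub, LinearMap.comp_apply, LinearMap.comp_apply, h₁, ← h₄, map_smul, mul_smul,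
      sub_eq_zero]
    rfl

theorem isGVTorsion_extM_of_flat {A B L N : Type} [AddCommGroup A] [Module R A] [Module.Finite R A]
    [AddCommGroup B] [Module R B] [Module.Free R B] [Module.Finite R B] [AddCommGroup L]
    [Module R L] [AddCommGroup N] [Module R N] (hL : IsGVTorsionFree R L) (hN : IsWModule R N)
    {f : A →ₗ[R] B} {u : B →ₗ[R] L} (hu : IsWEpi R u)
    (hfu : ∀ P : Ideal R, IsMaxWIdeal R P → ∀ [P.IsPrime],
      Function.Exact (locMap R P.primeCompl f) (locMap R P.primeCompl u))
    (hflat : ∀ P : Ideal R, IsMaxWIdeal R P → ∀ [P.IsPrime],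
      Module.Flat R (LocalizedModule P.primeCompl L)) :
    IsGVTorsion R (extM R L N 1) := by
  have huf : ∀ a, u (f a) = 0 := fun a => hL.eq_zero fun P hP _ =>
    ((IsLocalizedModule.exact_map_iff _ _ _ _ _ _).mp (hfu P hP)).1 a
  obtain ⟨J, hJ, hJI⟩ := exists_isGVIdeal_le (I := liftableScalars f) fun P hP _ =>
    have := hflat P hP
    exists_mem_liftableScalars (LinearMap.ext huf) (hfu P hP) (hu P hP)
  intro e
  refine ⟨J, hJ, fun s hs => ?_⟩
  obtain ⟨σ, hσ, hσs⟩ := hJI hs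
  obtain ⟨p, hp⟩ : ∃ p : (L →₀ R) →ₗ[R] L, Function.Surjective p :=
    ⟨_, Finsupp.linearCombination_id_surjective R L⟩
  obtain ⟨Φ, hΦ, hΦ0⟩ := exists_ker_surjection_ext (N := N) p hp
  obtain ⟨φ, rfl⟩ := hΦ e
  obtain ⟨w, hlift⟩ := Module.projective_lifting_property p u hp
  have hlift' : ∀ x, p (w x) = u x := fun x => congr($hlift x)
  let v : B →ₗ[R] LinearMap.ker p := (w ∘ₗ (s • LinearMap.id - σ)).codRestrict _ fun x => by
    obtain ⟨a, ha⟩ := hσs x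
    change p (w (s • x - σ x)) = 0
    rw [hlift', ← ha, huf]
  let T : LinearMap.ker p × B →ₗ[R] L →₀ R := (LinearMap.ker p).subtype.coprod w
  have hT : ∀ b : L →₀ R, ∃ K : Ideal R, IsGVIdeal R K ∧
      ∀ j ∈ K, ∃ a : LinearMap.ker p × B, T a = j • b := fun b => by
    obtain ⟨K, hK, hb⟩ := exists_isGVIdeal_smul_mem_range hu (p b)
    refine ⟨K, hK, fun j hj => ?_⟩
    obtain ⟨x, hx⟩ := hb j hj
    exact ⟨(⟨j • b - w x, by rw [LinearMap.mem_ker, map_sub, map_smul, hlift', hx, sub_self]⟩, x),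
      by simp [T]⟩
  have hθ : ∀ a : LinearMap.ker p × B, T a = 0 → (s • φ).coprod (φ ∘ₗ v) a = 0 := by
    rintro ⟨k, x⟩ hkx
    have hkx' : (k : L →₀ R) + w x = 0 := by simpa [T] using hkx
    have hux : u x = 0 := by simpa [hlift'] using congr(p $hkx')
    have hw : (s • φ).coprod (φ ∘ₗ v) (k, x) = φ (s • k + v x) := by simp
    rw [hw]
    refine hN.1.eq_zero fun P hP _ => ?_
    obtain ⟨r, hr, a, ha⟩ :=
      ((IsLocalizedModule.exact_map_iff _ _ _ _ _ _).mp (hfu P hP)).2 x hux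
    refine ⟨r, hr, ?_⟩
    have hσx : r • σ x = 0 := by rw [← map_smul, ← ha]; exact congr($hσ a)
    have : r • (s • k + v x) = 0 := by
      ext1
      change r • (s • (k : L →₀ R) + w (s • x - σ x)) = 0
      rw [map_sub, map_smul, ← add_sub_assoc, ← smul_add, hkx', smul_zero, zero_sub, smul_neg,
        ← map_smul, hσx, map_zero, neg_zero]
    rw [← map_smul, this, map_zero]
  obtain ⟨ψ, hψ⟩ := IsWModule.exists_extension (A := LinearMap.ker p × B) hN T hT _ hθ
  rw [← map_smul]
  refine (hΦ0 _).mpr ⟨ψ, LinearMap.ext fun k => ?_⟩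
  simpa [T] using congr($hψ (k, 0))

theorem IsFinitelyPresentedType.isWProjective {C : Type} [AddCommGroup C] [Module R C]
    (hC : IsFinitelyPresentedType R C)
    (hflat : ∀ P : Ideal R, IsMaxWIdeal R P → ∀ [P.IsPrime],
      Module.Flat R (LocalizedModule P.primeCompl C)) : IsWProjective R C := by
  obtain ⟨m, n, f, g, hg, hfg⟩ := hC
  intro N _ _ _ hN L _ _ ι hι
  have hcomp : ∀ (P : Ideal R) [P.IsPrime], ⇑(locMap R P.primeCompl ((ι ∘ₗ (torGV R C).mkQ) ∘ₗ g)) =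
      ⇑(locMap R P.primeCompl (ι ∘ₗ (torGV R C).mkQ)) ∘ ⇑(locMap R P.primeCompl g) := fun P _ =>
    congrArg DFunLike.coe (IsLocalizedModule.map_comp' P.primeCompl _ _ _ g (ι ∘ₗ (torGV R C).mkQ))
  refine isGVTorsion_extM_of_flat hι.1.1 hN (f := f) (u := (ι ∘ₗ (torGV R C).mkQ) ∘ₗ g)
    (fun P hP _ => ?_) (fun P hP _ => ?_) fun P hP _ => ?_
  · rw [hcomp]
    exact (hι.bijective_locMap hP).2.comp (hg P hP)
  · intro x
    rw [hcomp, Function.comp_apply, map_eq_zero_iff _ (hι.bijective_locMap hP).1]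
    exact hfg P hP x
  · have := hflat P hP
    exact .of_linearEquiv (LinearEquiv.ofBijective _ (hι.bijective_locMap hP)).symm

theorem IsWProjective.isWeakWProjective {M : Type} [AddCommGroup M] [Module R M]
    (hM : IsWProjective R M) : IsWeakWProjective R M := fun _ _ _ hN =>
  hN.2 M hM 1 le_rfl

theorem flat_localizedModule_of_wPure {C : Type} [AddCommGroup C] [Module R C]
    (h : ∀ (A B : Type) [AddCommGroup A] [Module R A] [AddCommGroup B] [Module R B]
      (f : A →ₗ[R] B) (g : B →ₗ[R] C), IsWShortExact R f g →
      ∀ (M : Type) [AddCommGroup M] [Module R M],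
        IsWShortExact R (LinearMap.rTensor M f) (LinearMap.rTensor M g))
    {P : Ideal R} [P.IsPrime] (hP : IsMaxWIdeal R P) :
    Module.Flat R (LocalizedModule P.primeCompl C) := by
  obtain ⟨p, hp⟩ : ∃ p : (C →₀ R) →ₗ[R] C, Function.Surjective p :=
    ⟨_, Finsupp.linearCombination_id_surjective R C⟩
  have hex : IsWShortExact (A := LinearMap.ker p) R (LinearMap.ker p).subtype p := by
    intro P _ _
    have hex := LinearMap.exact_subtype_ker_map p
    exact ⟨injective_locMap (Submodule.injective_subtype _), exact_locMap hex,
      surjective_locMap hp⟩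
  have := flat_localizedModule (S := P.primeCompl) (C →₀ R)
  exact flat_of_rTensor_injective (hex P hP).2.1 (hex P hP).2.2 fun I =>
    (injective_locMap_rTensor_iff _ _).mp (h _ _ _ _ hex (R ⧸ I) P hP).1

end FinitelyPresentedType

/-- a module `C` of finitely presented type is weak `w`-projective iff
every `w`-exact sequence `0 → A → B → C → 0` is `w`-pure exact. -/
theorem weakWProjective_iff_wPure (R : Type) [CommRing R]
    (C : Type) [AddCommGroup C] [Module R C] (hC : IsFinitelyPresentedType R C) :
    IsWeakWProjective R C ↔
      ∀ (A B : Type) [AddCommGroup A] [Module R A] [AddCommGroup B] [Module R B]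
        (f : A →ₗ[R] B) (g : B →ₗ[R] C), IsWShortExact R f g →
        ∀ (M : Type) [AddCommGroup M] [Module R M],
          IsWShortExact R (LinearMap.rTensor M f) (LinearMap.rTensor M g) := by
  constructor
  · intro h A B _ _ _ _ f g hfg M _ _ P hP _
    obtain ⟨h₁, h₂, h₃⟩ := hfg P hP
    have := h.flat_localizedModule hP
    exact ⟨(injective_locMap_rTensor_iff f M).mpr (rTensor_injective_of_flat h₁ h₂ h₃ M),
      (exact_locMap_rTensor_iff f g M).mpr (rTensor_exact M h₂ h₃),
      (surjective_locMap_rTensor_iff g M).mpr (LinearMap.rTensor_surjective M h₃)⟩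
  · intro h
    exact (hC.isWProjective fun P hP _ => flat_localizedModule_of_wPure h hP).isWeakWProjective
end

section
/- Let R be a commutative ring, M an R-module, and m ≥ 1 an integer. Then the weak w-projective dimension of M is at most m if and only if Ext^m_R(M, D) = 0 for every P_w^{†∞}-divisible R-module D. -/
/-!  Background definitions for the `w`-operation theory of Wang–Kim–Qiao.  -/

open CategoryTheory

section Dimension

variable (R : Type) [CommRing R]

/-- The weak `w`-projective dimension of `M` is at most `n`: there is an exact sequence
`0 → P_n → ⋯ → P_1 → P_0 → M → 0` with every `P_i` weak `w`-projective.  (The sequence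
is encoded by padding with zero modules on the left.) -/
def WWPdimLE (M : Type) [AddCommGroup M] [Module R M] (n : ℕ) : Prop :=
  ∃ (P : ℕ → ModuleCat R) (d : ∀ i : ℕ, ↥(P (i + 1)) →ₗ[R] ↥(P i)) (e : ↥(P 0) →ₗ[R] M),
    (∀ i, IsWeakWProjective R ↥(P i)) ∧
    (∀ i, n < i → Subsingleton ↥(P i)) ∧
    Function.Surjective e ∧
    Function.Exact ⇑(d 0) ⇑e ∧
    ∀ i : ℕ, Function.Exact ⇑(d (i + 1)) ⇑(d i)

/-- The weak `w`-projective dimension of `M`, as an element of `ℕ ∪ {∞}`. -/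
noncomputable def wwpd (M : Type) [AddCommGroup M] [Module R M] : ℕ∞ :=
  sInf {c : ℕ∞ | ∃ n : ℕ, c = n ∧ WWPdimLE R M n}

end Dimension

/-- `D` is `P_w^{†∞}`-divisible: `D ≅ E/N` with `E` a GV-torsion-free injective module
and `N ∈ P_w^{†∞}` a submodule of `E`. -/
def IsPwDivisible (R : Type) [CommRing R] (D : Type) [AddCommGroup D] [Module R D] : Prop :=
  ∃ (E : ModuleCat R) (N : Submodule R E),
    IsGVTorsionFree R E ∧ Module.Injective R E ∧ MemPwDaggerInfty R N ∧
      Nonempty (D ≃ₗ[R] (E ⧸ N))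

section ExtLemmas

variable {R : Type} [CommRing R]

/-- In positive degrees, vanishing of the derived-functor `Ext` is the same as vanishing of
the `Ext` of the derived category. -/
theorem subsingleton_extM_succ_iff (M N : Type) [AddCommGroup M] [Module R M]
    [AddCommGroup N] [Module R N] (n : ℕ) :
    Subsingleton (extM R M N (n + 1)) ↔
      Subsingleton (Abelian.Ext.{0} (ModuleCat.of R M) (ModuleCat.of R N) (n + 1)) := by
  let P := ProjectiveResolution.of (ModuleCat.of R M)
  have h₁ : Subsingleton (extM R M N (n + 1)) ↔
      ∀ f : P.complex.X (n + 1) ⟶ ModuleCat.of R N, P.complex.d (n + 2) (n + 1) ≫ f = 0 →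
        ∃ g : P.complex.X n ⟶ ModuleCat.of R N, P.complex.d (n + 1) n ≫ g = f := by
    rw [← ModuleCat.isZero_iff_subsingleton, extM, (P.isoExt (n + 1) _).isZero_iff,
      ← HomologicalComplex.exactAt_iff_isZero_homology,
      HomologicalComplex.exactAt_iff' _ n (n + 1) (n + 2) (by simp) (by simp),
      ShortComplex.moduleCat_exact_iff]
    rfl
  rw [h₁]
  constructor
  · refine fun h ↦ subsingleton_of_forall_eq 0 fun α ↦ ?_
    obtain ⟨f, hf, rfl⟩ := P.extMk_surjective α (n + 2) rfl
    exact (P.extMk_eq_zero_iff f (n + 2) rfl hf n rfl).2 (h f hf)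
  · exact fun h f hf ↦ (P.extMk_eq_zero_iff f (n + 2) rfl hf n rfl).1 (Subsingleton.elim _ _)

theorem subsingleton_extM_of_projective (M N : Type) [AddCommGroup M] [Module R M]
    [AddCommGroup N] [Module R N] [Module.Projective R M] (n : ℕ) :
    Subsingleton (extM R M N (n + 1)) :=
  ModuleCat.isZero_iff_subsingleton.1 (isZero_Ext_succ_of_projective _ _ n)

theorem subsingleton_extM_congr_left {M M' : Type} [AddCommGroup M] [Module R M]
    [AddCommGroup M'] [Module R M'] (e : M ≃ₗ[R] M') (N : Type) [AddCommGroup N] [Module R N]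
    (n : ℕ) (h : Subsingleton (extM R M N n)) : Subsingleton (extM R M' N n) :=
  ((((Ext R (ModuleCat R) n).mapIso e.toModuleIso.symm.op).app
    (ModuleCat.of R N)).toLinearEquiv.toEquiv.subsingleton_congr).1 h

theorem subsingleton_extM_congr_right (M : Type) {N N' : Type} [AddCommGroup M] [Module R M]
    [AddCommGroup N] [Module R N] [AddCommGroup N'] [Module R N'] (e : N ≃ₗ[R] N')
    (n : ℕ) (h : Subsingleton (extM R M N n)) : Subsingleton (extM R M N' n) :=
  ((((Ext R (ModuleCat R) n).obj (Opposite.op (ModuleCat.of R M))).mapIso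
    e.toModuleIso).toLinearEquiv.toEquiv.subsingleton_congr).1 h

theorem shortExact_subtype_mkQ {E : Type} [AddCommGroup E] [Module R E] (K : Submodule R E) :
    (ShortComplex.mk (ModuleCat.ofHom K.subtype) (ModuleCat.ofHom K.mkQ)
      (by ext x; simp)).ShortExact where
  exact := by
    rw [ShortComplex.moduleCat_exact_iff]
    intro x hx
    exact ⟨⟨x, (Submodule.Quotient.mk_eq_zero K).1 hx⟩, rfl⟩
  mono_f := (ModuleCat.mono_iff_injective _).2 K.injective_subtype
  epi_g := (ModuleCat.epi_iff_surjective _).2 K.mkQ_surjective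

theorem shortExact_ker_subtype {P M : Type} [AddCommGroup P] [Module R P] [AddCommGroup M]
    [Module R M] {e : P →ₗ[R] M} (he : Function.Surjective e) :
    (ShortComplex.mk (ModuleCat.ofHom (LinearMap.ker e).subtype) (ModuleCat.ofHom e)
      (by ext x; exact x.2)).ShortExact where
  exact := by
    rw [ShortComplex.moduleCat_exact_iff]
    exact fun x hx ↦ ⟨⟨x, hx⟩, rfl⟩
  mono_f := (ModuleCat.mono_iff_injective _).2 (LinearMap.ker e).injective_subtype
  epi_g := (ModuleCat.epi_iff_surjective _).2 he

theorem subsingleton_extM_submodule (X : Type) {E : Type} [AddCommGroup X] [Module R X]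
    [AddCommGroup E] [Module R E] [Module.Injective R E] (K : Submodule R E) (n : ℕ)
    (h : Subsingleton (extM R X (E ⧸ K) (n + 1))) : Subsingleton (extM R X K (n + 2)) := by
  rw [subsingleton_extM_succ_iff] at h ⊢
  have : Injective (ModuleCat.of R E) := Module.injective_object_of_injective_module R E
  refine subsingleton_of_forall_eq 0 fun α ↦ ?_
  obtain ⟨β, rfl⟩ := Abelian.Ext.covariant_sequence_exact₁ _ (shortExact_subtype_mkQ K) α
    (Abelian.Ext.eq_zero_of_injective _) (n₀ := n + 1) rfl
  rw [Subsingleton.elim β 0, Abelian.Ext.zero_comp]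

theorem subsingleton_extM_quotient (X : Type) {E : Type} [AddCommGroup X] [Module R X]
    [AddCommGroup E] [Module R E] [Module.Injective R E] (K : Submodule R E) (n : ℕ)
    (h : Subsingleton (extM R X K (n + 2))) : Subsingleton (extM R X (E ⧸ K) (n + 1)) := by
  rw [subsingleton_extM_succ_iff] at h ⊢
  have : Injective (ModuleCat.of R E) := Module.injective_object_of_injective_module R E
  refine subsingleton_of_forall_eq 0 fun α ↦ ?_
  obtain ⟨β, rfl⟩ := Abelian.Ext.covariant_sequence_exact₃ _ (shortExact_subtype_mkQ K) α
    (n₁ := n + 2) rfl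
    (Subsingleton.elim (α := Abelian.Ext (ModuleCat.of R X) (ModuleCat.of R K) _) _ _)
  rw [Abelian.Ext.eq_zero_of_injective β, Abelian.Ext.zero_comp]

theorem subsingleton_extM_ker {P M : Type} [AddCommGroup P] [Module R P] [AddCommGroup M]
    [Module R M] {e : P →ₗ[R] M} (he : Function.Surjective e) (N : Type) [AddCommGroup N]
    [Module R N] (n : ℕ) (hP : Subsingleton (extM R P N (n + 1)))
    (hM : Subsingleton (extM R M N (n + 2))) :
    Subsingleton (extM R (LinearMap.ker e) N (n + 1)) := by
  rw [subsingleton_extM_succ_iff] at hP hM ⊢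
  refine subsingleton_of_forall_eq 0 fun α ↦ ?_
  obtain ⟨β, rfl⟩ := Abelian.Ext.contravariant_sequence_exact₁ (shortExact_ker_subtype he) _ α
    (n₁ := n + 2) (by omega)
    (Subsingleton.elim (α := Abelian.Ext (ModuleCat.of R M) (ModuleCat.of R N) _) _ _)
  rw [Subsingleton.elim (α := Abelian.Ext (ModuleCat.of R P) (ModuleCat.of R N) _) β 0,
    Abelian.Ext.comp_zero]

theorem subsingleton_extM_of_ker {P M : Type} [AddCommGroup P] [Module R P] [AddCommGroup M]
    [Module R M] {e : P →ₗ[R] M} (he : Function.Surjective e) (N : Type) [AddCommGroup N]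
    [Module R N] (n : ℕ) (hP : Subsingleton (extM R P N (n + 2)))
    (hK : Subsingleton (extM R (LinearMap.ker e) N (n + 1))) :
    Subsingleton (extM R M N (n + 2)) := by
  rw [subsingleton_extM_succ_iff] at hP hK ⊢
  refine subsingleton_of_forall_eq 0 fun α ↦ ?_
  obtain ⟨β, rfl⟩ := Abelian.Ext.contravariant_sequence_exact₃ (shortExact_ker_subtype he) _ α
    (Subsingleton.elim (α := Abelian.Ext (ModuleCat.of R P) (ModuleCat.of R N) _) _ _)
    (n₀ := n + 1) (by omega)
  rw [Subsingleton.elim (α := Abelian.Ext (ModuleCat.of R (LinearMap.ker e))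
    (ModuleCat.of R N) _) β 0, Abelian.Ext.comp_zero]

/-- If `Ext¹(X, K) = 0`, then linear maps `X → E ⧸ K` lift to `E`. -/
theorem exists_lift_of_subsingleton_extM_one {X E : Type} [AddCommGroup X] [Module R X]
    [AddCommGroup E] [Module R E] (K : Submodule R E) (h : Subsingleton (extM R X K 1))
    (f : X →ₗ[R] E ⧸ K) : ∃ g : X →ₗ[R] E, K.mkQ ∘ₗ g = f := by
  rw [subsingleton_extM_succ_iff] at h
  obtain ⟨β, hβ⟩ := Abelian.Ext.covariant_sequence_exact₃ _ (shortExact_subtype_mkQ K)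
    (Abelian.Ext.mk₀ (ModuleCat.ofHom f)) (n₁ := 1) rfl
    (Subsingleton.elim (α := Abelian.Ext (ModuleCat.of R X) (ModuleCat.of R K) _) _ _)
  obtain ⟨g, rfl⟩ := (Abelian.Ext.mk₀_bijective _ _).2 β
  rw [Abelian.Ext.mk₀_comp_mk₀] at hβ
  exact ⟨g.hom, congrArg ModuleCat.Hom.hom ((Abelian.Ext.mk₀_bijective _ _).1 hβ)⟩

end ExtLemmas

section TorsionFree

variable {R : Type} [CommRing R]

theorem IsGVTorsionFree.of_injective {M N : Type} [AddCommGroup M] [Module R M]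
    [AddCommGroup N] [Module R N] (hN : IsGVTorsionFree R N) (f : M →ₗ[R] N)
    (hf : Function.Injective f) : IsGVTorsionFree R M := by
  rintro x ⟨J, hJ, hx⟩
  refine hf ((hN (f x) ⟨J, hJ, fun j hj ↦ ?_⟩).trans f.map_zero.symm)
  rw [← f.map_smul, hx j hj, f.map_zero]

/-- Every `GV`-torsion-free submodule is contained in a maximal one. -/
theorem exists_maximal_torsionFree {E : Type} [AddCommGroup E] [Module R E]
    (K : Submodule R E) (hK : IsGVTorsionFree R K) :
    ∃ K', K ≤ K' ∧ Maximal (fun L : Submodule R E ↦ IsGVTorsionFree R L) K' := by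
  refine zorn_le_nonempty₀ {L : Submodule R E | IsGVTorsionFree R L} ?_ K hK
  intro c hc hchain L hL
  refine ⟨sSup c, ?_, fun _ ↦ le_sSup⟩
  rintro ⟨x, hx⟩ ⟨J, hJ, hxJ⟩
  obtain ⟨A, hA, hxA⟩ := (Submodule.mem_sSup_of_directed ⟨L, hL⟩ hchain.directedOn).1 hx
  have hxA0 := hc hA ⟨x, hxA⟩
    ⟨J, hJ, fun j hj ↦ Subtype.ext (show j • x = 0 from Subtype.ext_iff.1 (hxJ j hj))⟩
  exact Subtype.ext (show x = 0 from Subtype.ext_iff.1 hxA0)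

theorem exists_maximal_disjoint {E : Type} [AddCommGroup E] [Module R E] (K : Submodule R E) :
    ∃ C, Maximal (fun L : Submodule R E ↦ Disjoint L K) C := by
  obtain ⟨C, -, hC⟩ := zorn_le_nonempty₀ {L : Submodule R E | Disjoint L K} (by
    intro c hc hchain L hL
    refine ⟨sSup c, Submodule.disjoint_def.2 fun x hx hxK ↦ ?_, fun _ ↦ le_sSup⟩
    obtain ⟨A, hA, hxA⟩ := (Submodule.mem_sSup_of_directed ⟨L, hL⟩ hchain.directedOn).1 hx
    exact Submodule.disjoint_def.1 (hc hA) x hxA hxK) ⊥ disjoint_bot_left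
  exact ⟨C, hC⟩

/-- A maximal `GV`-torsion-free submodule of an injective module is injective. -/
theorem injective_of_maximal_torsionFree {E : Type} [AddCommGroup E] [Module R E]
    [Module.Injective R E] {K : Submodule R E}
    (hK : Maximal (fun L : Submodule R E ↦ IsGVTorsionFree R L) K) : Module.Injective R K := by
  obtain ⟨C, hC⟩ := exists_maximal_disjoint K
  have hess : ∀ x, x ∉ C → ∃ r : R, ∃ k ∈ K, k ≠ 0 ∧ r • x - k ∈ C := by
    intro x hx
    by_contra! H
    refine hx (hC.2 (y := C ⊔ R ∙ x) (Submodule.disjoint_def.2 fun y hy hyK ↦ ?_) le_sup_left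
      (Submodule.mem_sup_right (Submodule.mem_span_singleton_self x)))
    obtain ⟨c, hc, z, hz, rfl⟩ := Submodule.mem_sup.1 hy
    obtain ⟨r, rfl⟩ := Submodule.mem_span_singleton.1 hz
    by_contra hne
    refine H r _ hyK hne ?_
    simpa using C.neg_mem hc
  have hinj : Function.Injective (C.mkQ ∘ₗ K.subtype) := by
    rw [← LinearMap.ker_eq_bot, LinearMap.ker_eq_bot']
    intro x hx
    exact Subtype.ext (Submodule.disjoint_def.1 hC.1 x
      ((Submodule.Quotient.mk_eq_zero C).1 hx) x.2)
  obtain ⟨h, hh⟩ := Module.Injective.out (C.mkQ ∘ₗ K.subtype) hinj K.subtype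
  let p : E →ₗ[R] E := h ∘ₗ C.mkQ
  have hpK : ∀ k ∈ K, p k = k := fun k hk ↦ hh ⟨k, hk⟩
  have hpC : ∀ c ∈ C, p c = 0 := fun c hc ↦ by
    simp [p, (Submodule.Quotient.mk_eq_zero C).2 hc]
  have hrange : ∀ x, p x ∈ K := by
    have hTF : IsGVTorsionFree R (LinearMap.range p) := by
      rintro ⟨_, x, rfl⟩ ⟨J, hJ, hx⟩
      by_contra hne
      obtain ⟨r, k, hk, hk0, hkC⟩ := hess x fun hxC ↦ hne (Subtype.ext (hpC x hxC))
      have hrk : r • p x = k := by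
        rw [← sub_eq_zero, ← p.map_smul]
        nth_rw 1 [← hpK k hk]
        rw [← p.map_sub, hpC _ hkC]
      refine hk0 (congrArg Subtype.val (hK.1 ⟨k, hk⟩ ⟨J, hJ, fun j hj ↦ Subtype.ext ?_⟩))
      have hj0 : j • p x = 0 := congrArg Subtype.val (hx j hj)
      change j • k = 0
      rw [← hrk, smul_comm, hj0, smul_zero]
    have hle : LinearMap.range p ≤ K := hK.2 hTF fun k hk ↦ ⟨k, hpK k hk⟩
    exact fun x ↦ hle ⟨x, rfl⟩
  refine ⟨fun X Y _ _ _ _ f hf g ↦ ?_⟩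
  obtain ⟨l, hl⟩ := Module.Injective.out f hf (K.subtype ∘ₗ g)
  refine ⟨p.codRestrict K hrange ∘ₗ l, fun x ↦ Subtype.ext ?_⟩
  change p (l (f x)) = g x
  rw [hl]
  exact hpK _ (g x).2

/-- Every `GV`-torsion-free module embeds in a `GV`-torsion-free injective module. -/
theorem exists_torsionFree_injective (N : Type) [AddCommGroup N] [Module R N]
    (hN : IsGVTorsionFree R N) :
    ∃ (E : ModuleCat.{0} R) (K : Submodule R E),
      IsGVTorsionFree R E ∧ Module.Injective R E ∧ Nonempty (N ≃ₗ[R] K) := by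
  let I := Injective.under (ModuleCat.of R N)
  let ι : N →ₗ[R] I := (Injective.ι (ModuleCat.of R N)).hom
  have hι : Function.Injective ι := (ModuleCat.mono_iff_injective _).1 inferInstance
  have : Injective (ModuleCat.of R I) := inferInstanceAs (Injective I)
  have : Module.Injective R I := Module.injective_module_of_injective_object R I
  let e := LinearEquiv.ofInjective ι hι
  obtain ⟨K', hle, hK'⟩ := exists_maximal_torsionFree (LinearMap.range ι)
    (hN.of_injective e.symm.toLinearMap e.symm.injective)
  let f : N →ₗ[R] K' := ι.codRestrict K' fun x ↦ hle ⟨x, rfl⟩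
  have hf : Function.Injective f := fun x y hxy ↦ hι (congrArg Subtype.val hxy)
  exact ⟨ModuleCat.of R K', LinearMap.range f, hK'.1, injective_of_maximal_torsionFree hK',
    ⟨LinearEquiv.ofInjective f hf⟩⟩

end TorsionFree

section WeakWProjective

variable {R : Type} [CommRing R]

theorem isWProjective_quotient_of_isGVIdeal {J : Ideal R} (hJ : IsGVIdeal R J) :
    IsWProjective R (R ⧸ J) := by
  intro N _ _ _ _ L _ _ ι hL
  have htop : torGV R (R ⧸ J) = ⊤ := by
    refine eq_top_iff.2 fun x _ ↦ Submodule.subset_span ⟨J, hJ, fun j hj ↦ ?_⟩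
    obtain ⟨r, rfl⟩ := Ideal.Quotient.mk_surjective x
    exact Ideal.Quotient.eq_zero_iff_mem.2 (J.mul_mem_right r hj)
  have hQ : Subsingleton ((R ⧸ J) ⧸ torGV R (R ⧸ J)) :=
    Submodule.Quotient.subsingleton_iff.2 htop
  have hL0 : Subsingleton L := by
    refine subsingleton_of_forall_eq 0 fun x ↦ ?_
    obtain ⟨I, hI, hx⟩ := hL.2.2 (Submodule.Quotient.mk x)
    refine hL.1.1 x ⟨I, hI, fun j hj ↦ ?_⟩
    obtain ⟨y, hy⟩ := (Submodule.Quotient.mk_eq_zero (LinearMap.range ι)).1 (hx j hj)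
    rw [Subsingleton.elim y 0, map_zero] at hy
    exact hy.symm
  have : Module.Free R L := Module.Free.of_subsingleton R L
  have := subsingleton_extM_of_projective (R := R) L N 0
  exact fun x ↦ ⟨J, hJ, fun j _ ↦ Subsingleton.elim _ _⟩

theorem MemPwDaggerInfty.of_equiv {N N' : Type} [AddCommGroup N] [Module R N]
    [AddCommGroup N'] [Module R N'] (hN : MemPwDaggerInfty R N) (e : N ≃ₗ[R] N') :
    MemPwDaggerInfty R N' :=
  ⟨hN.1.of_injective e.symm.toLinearMap e.symm.injective, fun M _ _ hM k hk ↦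
    subsingleton_extM_congr_right M e k (hN.2 M hM k hk)⟩

/-- The class `P_w^{†∞}` is closed under cosyzygies in `GV`-torsion-free injectives. -/
theorem MemPwDaggerInfty.quotient {E : Type} [AddCommGroup E] [Module R E]
    [Module.Injective R E] (hE : IsGVTorsionFree R E) {K : Submodule R E}
    (hK : MemPwDaggerInfty R K) : MemPwDaggerInfty R (E ⧸ K) := by
  refine ⟨?_, fun M _ _ hM k hk ↦ ?_⟩
  · rintro x ⟨J, hJ, hx⟩
    obtain ⟨g, hg⟩ := exists_lift_of_subsingleton_extM_one K
      (hK.2 _ (isWProjective_quotient_of_isGVIdeal hJ) 1 le_rfl)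
      (Submodule.liftQ J (LinearMap.toSpanSingleton R (E ⧸ K) x) fun j hj ↦ hx j hj)
    have hg1 : g (Submodule.Quotient.mk 1) = 0 := by
      refine hE _ ⟨J, hJ, fun j hj ↦ ?_⟩
      rw [← g.map_smul, ← Submodule.Quotient.mk_smul, smul_eq_mul, mul_one,
        (Submodule.Quotient.mk_eq_zero J).2 hj, map_zero]
    have := LinearMap.congr_fun hg (Submodule.Quotient.mk 1)
    rw [LinearMap.comp_apply, hg1, map_zero] at this
    exact (one_smul R x).symm.trans this.symm
  · obtain ⟨n, rfl⟩ := Nat.exists_eq_add_of_le' hk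
    exact subsingleton_extM_quotient M K n (hK.2 M hM (n + 2) (by omega))

theorem MemPwDaggerInfty.exists_injective {N : Type} [AddCommGroup N] [Module R N]
    (hN : MemPwDaggerInfty R N) :
    ∃ (E : ModuleCat.{0} R) (K : Submodule R E), IsGVTorsionFree R E ∧ Module.Injective R E ∧
      MemPwDaggerInfty R K ∧ Nonempty (N ≃ₗ[R] K) := by
  obtain ⟨E, K, hE, hI, ⟨e⟩⟩ := exists_torsionFree_injective N hN.1
  exact ⟨E, K, hE, hI, hN.of_equiv e, ⟨e⟩⟩

theorem IsWeakWProjective.subsingleton_extM {M : Type} [AddCommGroup M] [Module R M]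
    (hM : IsWeakWProjective R M) (k : ℕ) {N : Type} [AddCommGroup N] [Module R N]
    (hN : MemPwDaggerInfty R N) : Subsingleton (extM R M N (k + 1)) := by
  induction k generalizing N with
  | zero => exact hM N hN
  | succ k ih =>
    obtain ⟨E, K, hE, hI, hK, ⟨e⟩⟩ := hN.exists_injective
    exact subsingleton_extM_congr_right M e.symm _
      (subsingleton_extM_submodule M K k (ih (hK.quotient hE)))

theorem isWeakWProjective_of_projective (M : Type) [AddCommGroup M] [Module R M]
    [Module.Projective R M] : IsWeakWProjective R M :=
  fun N _ _ _ ↦ subsingleton_extM_of_projective M N 0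

theorem WWPdimLE.subsingleton_extM {M : Type} [AddCommGroup M] [Module R M] {n : ℕ}
    (h : WWPdimLE R M n) (k : ℕ) {N : Type} [AddCommGroup N] [Module R N]
    (hN : MemPwDaggerInfty R N) : Subsingleton (extM R M N (n + k + 1)) := by
  induction n generalizing M with
  | zero =>
    obtain ⟨P, d, e, hP, hP0, he, hde, -⟩ := h
    have := hP0 1 one_pos
    have hinj : Function.Injective e := by
      rw [← LinearMap.ker_eq_bot, LinearMap.ker_eq_bot']
      intro x hx
      obtain ⟨y, rfl⟩ := (hde x).1 hx
      rw [Subsingleton.elim y 0, map_zero]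
    rw [Nat.zero_add]
    exact subsingleton_extM_congr_left (LinearEquiv.ofBijective e ⟨hinj, he⟩) N _
      ((hP 0).subsingleton_extM k hN)
  | succ n ih =>
    obtain ⟨P, d, e, hP, hP0, he, hde, hd⟩ := h
    have hK : WWPdimLE R (LinearMap.ker e) n := by
      refine ⟨fun i ↦ P (i + 1), fun i ↦ d (i + 1),
        (d 0).codRestrict (LinearMap.ker e) fun x ↦ hde.apply_apply_eq_zero x,
        fun i ↦ hP (i + 1), fun i hi ↦ hP0 (i + 1) (by omega), ?_, ?_, fun i ↦ hd (i + 1)⟩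
      · rintro ⟨x, hx⟩
        obtain ⟨y, rfl⟩ := (hde x).1 hx
        exact ⟨y, rfl⟩
      · exact fun x ↦ Subtype.ext_iff.trans (hd 0 x)
    have := subsingleton_extM_of_ker he N (n + k) ((hP 0).subsingleton_extM _ hN) (ih hK)
    rwa [show n + 1 + k + 1 = n + k + 2 by omega]

theorem WWPdimLE.succ_of_ker {P M : Type} [AddCommGroup P] [Module R P] [AddCommGroup M]
    [Module R M] {e : P →ₗ[R] M} (he : Function.Surjective e) (hP : IsWeakWProjective R P)
    {n : ℕ} (h : WWPdimLE R (LinearMap.ker e) n) : WWPdimLE R M (n + 1) := by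
  obtain ⟨Q, d, f, hQ, hQ0, hf, hdf, hd⟩ := h
  refine ⟨fun i ↦ Nat.casesOn i (ModuleCat.of R P) Q,
    fun i ↦ Nat.casesOn i ((LinearMap.ker e).subtype ∘ₗ f) d, e, ?_, ?_, he, ?_, ?_⟩
  · rintro (_ | i)
    exacts [hP, hQ i]
  · rintro (_ | i) hi
    exacts [absurd hi (by omega), hQ0 i (by omega)]
  · intro x
    constructor
    · intro hx
      obtain ⟨y, hy⟩ := hf ⟨x, hx⟩
      exact ⟨y, congrArg Subtype.val hy⟩
    · rintro ⟨y, rfl⟩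
      exact (f y).2
  · rintro (_ | i)
    · exact fun x ↦ Subtype.ext_iff.symm.trans (hdf x)
    · exact hd i

theorem IsWeakWProjective.wwpdimLE_zero {M : Type} [AddCommGroup M] [Module R M]
    (hM : IsWeakWProjective R M) : WWPdimLE R M 0 := by
  refine ⟨fun i ↦ Nat.casesOn i (ModuleCat.of R M) fun _ ↦ ModuleCat.of R PUnit,
    fun i ↦ 0, LinearMap.id, ?_, ?_, Function.surjective_id, ?_, ?_⟩
  · rintro (_ | i)
    exacts [hM, isWeakWProjective_of_projective PUnit]
  · rintro (_ | i) hi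
    exacts [absurd hi (lt_irrefl 0), inferInstanceAs (Subsingleton PUnit)]
  · exact fun x ↦ ⟨fun hx ↦ ⟨0, hx.symm⟩, fun ⟨_, hy⟩ ↦ hy.symm⟩
  · exact fun i x ↦ ⟨fun _ ↦ ⟨0, Subsingleton.elim (α := PUnit) _ _⟩, fun _ ↦ rfl⟩

theorem wwpdimLE_of_subsingleton_extM {M : Type} [AddCommGroup M] [Module R M] {n : ℕ}
    (h : ∀ (N : Type) [AddCommGroup N] [Module R N], MemPwDaggerInfty R N →
      Subsingleton (extM R M N (n + 1))) : WWPdimLE R M n := by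
  induction n generalizing M with
  | zero => exact IsWeakWProjective.wwpdimLE_zero h
  | succ n ih =>
    have he : Function.Surjective (Finsupp.linearCombination R (id : M → M)) :=
      Finsupp.linearCombination_id_surjective R M
    exact (ih fun N _ _ hN ↦ subsingleton_extM_ker he N n
      (subsingleton_extM_of_projective _ N n) (h N hN)).succ_of_ker he
        (isWeakWProjective_of_projective _)

theorem wwpd_le_iff_exists {M : Type} [AddCommGroup M] [Module R M] {m : ℕ} :
    wwpd R M ≤ m ↔ ∃ n ≤ m, WWPdimLE R M n := by
  constructor
  · intro h
    have hne : {c : ℕ∞ | ∃ n : ℕ, c = n ∧ WWPdimLE R M n}.Nonempty := by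
      by_contra hne
      rw [wwpd, Set.not_nonempty_iff_eq_empty.1 hne, sInf_empty, top_le_iff] at h
      exact ENat.natCast_ne_top m h
    obtain ⟨n, hn, hM⟩ := csInf_mem hne
    rw [wwpd, hn] at h
    exact ⟨n, by exact_mod_cast h, hM⟩
  · rintro ⟨n, hn, hM⟩
    have h : wwpd R M ≤ n := sInf_le ⟨n, rfl, hM⟩
    exact h.trans (by exact_mod_cast hn)

end WeakWProjective

/-- for `m ≥ 1`, the weak `w`-projective dimension of `M` is at most `m`
iff `Ext^m_R(M, D) = 0` for every `P_w^{†∞}`-divisible module `D`. -/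
theorem wwpd_le_iff_ext_divisible (R : Type) [CommRing R]
    (M : Type) [AddCommGroup M] [Module R M] (m : ℕ) (hm : 1 ≤ m) :
    wwpd R M ≤ (m : ℕ∞) ↔
      ∀ (D : Type) [AddCommGroup D] [Module R D], IsPwDivisible R D →
        Subsingleton (extM R M D m) := by

  obtain ⟨m, rfl⟩ := Nat.exists_eq_add_of_le' hm
  rw [wwpd_le_iff_exists]
  constructor
  · rintro ⟨n, hn, hM⟩ D _ _ ⟨E, K, hE, hI, hK, ⟨e⟩⟩
    refine subsingleton_extM_congr_right M e.symm _ (subsingleton_extM_quotient M K m ?_)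
    obtain ⟨k, hk⟩ := Nat.exists_eq_add_of_le hn
    have := hM.subsingleton_extM k hK
    rwa [← hk] at this
  · intro h
    refine ⟨m + 1, le_rfl, wwpdimLE_of_subsingleton_extM fun N _ _ hN ↦ ?_⟩
    obtain ⟨E, K, hE, hI, hK, ⟨e⟩⟩ := hN.exists_injective
    exact subsingleton_extM_congr_right M e.symm _ (subsingleton_extM_submodule M K m
      (h _ ⟨E, K, hE, hI, hK, ⟨LinearEquiv.refl R _⟩⟩))
end
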